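/- arXiv:1405.6607 — 3 statements merged into one kernel-verified Lean document; each statement's English description precedes it below -/
import Mathlib

section
/- Let n ≥ 2, let U ⊆ ℂ^{n−1} be open, let H be holomorphic on U, and suppose that the function F(t) = ½(t¹)²tⁿ + ½t¹∑_{i=2}^{n−1} tⁱ t^{n+1−i} + H(t²,…,tⁿ) satisfies the WDVV equation at every point of ℂ × U. Then for every A = ((a,b),(c,d)) ∈ SL(2,ℂ), the function F^A satisfies the WDVV equation at every point t ∈ ℂⁿ with ctⁿ+d ≠ 0 and (t²/(ctⁿ+d),…,t^{n−1}/(ctⁿ+d),(atⁿ+b)/(ctⁿ+d)) ∈ U. -/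
open Finset

/-- The third partial derivative `∂³F/∂tⁱ∂tʲ∂tᵏ` at `t`. -/
noncomputable def D3 {n : ℕ} (F : (Fin n → ℂ) → ℂ) (t : Fin n → ℂ) (i j k : Fin n) : ℂ :=
  iteratedFDeriv ℂ 3 F t ![Pi.single i 1, Pi.single j 1, Pi.single k 1]

/-- `F` satisfies the WDVV equation at `t`, with the pairing `η_{pq} = δ_{p+q,n+1}` in
1-based coordinates, i.e. `η^{pq} = 1` iff `p + q = n - 1` in 0-based coordinates. -/
def WDVVAt {n : ℕ} (F : (Fin n → ℂ) → ℂ) (t : Fin n → ℂ) : Prop :=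
  ∀ i j k l : Fin n,
    (∑ p : Fin n, ∑ q : Fin n,
      if (p : ℕ) + (q : ℕ) = n - 1 then D3 F t i j p * D3 F t q k l else 0)
    = ∑ p : Fin n, ∑ q : Fin n,
      if (p : ℕ) + (q : ℕ) = n - 1 then D3 F t i k p * D3 F t q j l else 0

/-- The last coordinate index (1-based `n`). -/
def lastIdx (n : ℕ) (hn : 2 ≤ n) : Fin n := ⟨n - 1, by omega⟩

/-- The projection `t = (t¹,…,tⁿ) ↦ (t²,…,tⁿ)`. -/
def tailArg {n : ℕ} (t : Fin n → ℂ) : Fin (n - 1) → ℂ :=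
  fun j => t ⟨(j : ℕ) + 1, by have := j.isLt; omega⟩

/-- The quadratic sum `∑_{i=2}^{n-1} tⁱ t^{n+1-i}` (1-based indexing). -/
noncomputable def midSum (n : ℕ) (hn : 2 ≤ n) (t : Fin n → ℂ) : ℂ :=
  ∑ i : Fin n, if 1 ≤ (i : ℕ) ∧ (i : ℕ) ≤ n - 2 then t i * t ⟨n - 1 - (i : ℕ), by omega⟩ else 0

/-- A potential in standard form: `F(t) = ½(t¹)²tⁿ + ½t¹ ∑_{i=2}^{n-1} tⁱt^{n+1-i} + G(t²,…,tⁿ)`. -/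
noncomputable def stdForm (n : ℕ) (hn : 2 ≤ n) (G : (Fin (n - 1) → ℂ) → ℂ) :
    (Fin n → ℂ) → ℂ :=
  fun t => 1 / 2 * (t ⟨0, by omega⟩) ^ 2 * t (lastIdx n hn)
    + 1 / 2 * t ⟨0, by omega⟩ * midSum n hn t
    + G (tailArg t)

/-- The argument of `H` in the transformed potential:
`(t²/(ctⁿ+d), …, t^{n-1}/(ctⁿ+d), (atⁿ+b)/(ctⁿ+d))`. -/
noncomputable def mobiusArg (n : ℕ) (hn : 2 ≤ n) (a b c d : ℂ) (t : Fin n → ℂ) :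
    Fin (n - 1) → ℂ :=
  fun j => if (j : ℕ) + 2 = n
    then (a * t (lastIdx n hn) + b) / (c * t (lastIdx n hn) + d)
    else t ⟨(j : ℕ) + 1, by have := j.isLt; omega⟩ / (c * t (lastIdx n hn) + d)

/-- The transformed potential `F^A` for `A = ((a,b),(c,d)) ∈ SL(2,ℂ)`. -/
noncomputable def slPotential (n : ℕ) (hn : 2 ≤ n) (a b c d : ℂ)
    (H : (Fin (n - 1) → ℂ) → ℂ) : (Fin n → ℂ) → ℂ :=
  fun t => 1 / 2 * (t ⟨0, by omega⟩) ^ 2 * t (lastIdx n hn)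
    + 1 / 2 * t ⟨0, by omega⟩ * midSum n hn t
    + c / (8 * (c * t (lastIdx n hn) + d)) * (midSum n hn t) ^ 2
    + (c * t (lastIdx n hn) + d) ^ 2 * H (mobiusArg n hn a b c d t)

section HolomorphicSmooth

open Metric Topology

variable {E : Type*} [NormedAddCommGroup E] [NormedSpace ℂ E]

theorem exists_ball_norm_fderiv_le {f : E → ℂ} {U : Set E} (hU : IsOpen U)
    (hf : DifferentiableOn ℂ f U) {x : E} (hx : x ∈ U) :
    ∃ r > 0, ∃ C : ℝ, ball x r ⊆ U ∧ ∀ y ∈ ball x r, ‖fderiv ℂ f y‖ ≤ C := by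
  obtain ⟨r, hr, hrU⟩ : ∃ r > 0, ball x (r + r) ⊆ U ∩ f ⁻¹' ball (f x) 1 := by
    have h : U ∩ f ⁻¹' ball (f x) 1 ∈ 𝓝 x :=
      Filter.inter_mem (hU.mem_nhds hx)
        ((hf.continuousOn.continuousAt (hU.mem_nhds hx)) (ball_mem_nhds _ one_pos))
    obtain ⟨r, hr, h⟩ := Metric.mem_nhds_iff.1 h
    exact ⟨r / 2, by positivity, by rwa [add_halves]⟩
  refine ⟨r, hr, 2 / r, fun y hy => (hrU (ball_subset_ball (by linarith) hy)).1, fun y hy => ?_⟩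
  have hsub : ball y r ⊆ ball x (r + r) := ball_subset_ball' (by
    have := mem_ball.1 hy; linarith)
  refine Complex.norm_fderiv_le_div_of_mapsTo_ball (hf.mono fun z hz => (hrU (hsub hz)).1) ?_ hr
  intro z hz
  have h1 := mem_ball.1 (hrU (hsub hz)).2
  have h2 := mem_ball.1 (hrU (ball_subset_ball (by linarith) hy : y ∈ ball x (r + r))).2
  have := dist_triangle_right (f z) (f y) (f x)
  exact mem_closedBall.2 (by linarith)

theorem differentiableOn_fderiv_apply_const [FiniteDimensional ℂ E] {f : E → ℂ} {U : Set E}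
    (hU : IsOpen U) (hf : DifferentiableOn ℂ f U) (v : E) :
    DifferentiableOn ℂ (fun x => fderiv ℂ f x v) U := by
  intro x₀ hx₀
  obtain ⟨R, hR, C, hRU, hC⟩ := exists_ball_norm_fderiv_le hU hf hx₀
  obtain ⟨ρ, hρ, hρv⟩ : ∃ ρ > 0, ρ * ‖v‖ < R / 2 := by
    refine ⟨R / 2 / (‖v‖ + 1), by positivity, ?_⟩
    rw [div_mul_eq_mul_div, div_lt_iff₀ (by positivity)]
    nlinarith [norm_nonneg v]
  have hmem : ∀ x ∈ ball x₀ (R / 2), ∀ z ∈ closedBall (0 : ℂ) ρ, x + z • v ∈ ball x₀ R := by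
    intro x hx z hz
    rw [mem_ball, dist_eq_norm] at hx ⊢
    have hz' : ‖z • v‖ ≤ ρ * ‖v‖ := by
      rw [norm_smul]; gcongr; simpa using hz
    have := norm_add_le (x - x₀) (z • v)
    rw [show x + z • v - x₀ = x - x₀ + z • v by abel]
    linarith
  have hcirc : ∀ θ, circleMap 0 ρ θ ∈ closedBall (0 : ℂ) ρ := fun θ =>
    circleMap_mem_closedBall 0 hρ.le θ
  set k : ℝ → ℂ := fun θ => deriv (circleMap 0 ρ) θ * ((circleMap 0 ρ θ - 0) ^ 2)⁻¹ with hk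
  have hkc : Continuous k := by
    have h0 : ∀ θ, (circleMap 0 ρ θ - 0) ^ 2 ≠ 0 := fun θ => by
      rw [sub_zero]; exact pow_ne_zero _ (circleMap_ne_center hρ.ne')
    have : k = fun θ => circleMap 0 ρ θ * Complex.I * ((circleMap 0 ρ θ - 0) ^ 2)⁻¹ := by
      ext θ; rw [hk]; simp only [deriv_circleMap]
    rw [this]
    have := continuous_circleMap 0 ρ
    exact (this.mul continuous_const).mul ((by fun_prop : Continuous fun θ =>
      (circleMap 0 ρ θ - 0) ^ 2).inv₀ h0)
  have hrep : ∀ x ∈ ball x₀ (R / 2), fderiv ℂ f x v =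
      (2 * Real.pi * Complex.I : ℂ)⁻¹ * ∫ θ in 0..2 * Real.pi,
        k θ * f (x + circleMap 0 ρ θ • v) := by
    intro x hx
    have hV : IsOpen {z : ℂ | x + z • v ∈ ball x₀ R} :=
      isOpen_ball.preimage (by fun_prop : Continuous fun z : ℂ => x + z • v)
    have hd : DifferentiableOn ℂ (fun z : ℂ => f (x + z • v)) {z : ℂ | x + z • v ∈ ball x₀ R} :=
      (hf.mono hRU).comp (by fun_prop) fun z hz => hz
    have h := Complex.cderiv_eq_deriv hV hd hρ (fun z hz => hmem x hx z hz)
    have hx' : x ∈ U := hRU (ball_subset_ball (by linarith) hx)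
    have h2 : HasDerivAt (fun z : ℂ => f (x + z • v)) (fderiv ℂ f x v) 0 := by
      have hl : HasDerivAt (fun z : ℂ => x + z • v) v 0 := by
        simpa using ((hasDerivAt_id (0 : ℂ)).smul_const v).const_add x
      have hfd : HasFDerivAt f (fderiv ℂ f x) (x + (0 : ℂ) • v) := by
        simpa using (hf.differentiableAt (hU.mem_nhds hx')).hasFDerivAt
      exact hfd.comp_hasDerivAt 0 hl
    rw [← h2.deriv, ← h, Complex.cderiv, circleIntegral, smul_eq_mul]
    simp only [hk, smul_eq_mul, mul_assoc]
  have hcont : ∀ x ∈ ball x₀ (R / 2),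
      Continuous fun θ => k θ * f (x + circleMap 0 ρ θ • v) := by
    intro x hx
    refine hkc.mul ((hf.continuousOn.mono hRU).comp_continuous ?_
      fun θ => hmem x hx _ (hcirc θ))
    have := continuous_circleMap 0 ρ
    fun_prop
  have hx₀' : x₀ ∈ ball x₀ (R / 2) := mem_ball_self (by positivity)
  have hball : ball x₀ (R / 2) ∈ 𝓝 x₀ := ball_mem_nhds _ (by positivity)
  have hint := intervalIntegral.hasFDerivAt_integral_of_dominated_of_fderiv_le (𝕜 := ℂ)
    (μ := MeasureTheory.volume) (a := 0) (b := 2 * Real.pi)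
    (F := fun x θ => k θ * f (x + circleMap 0 ρ θ • v))
    (F' := fun x θ => k θ • fderiv ℂ f (x + circleMap 0 ρ θ • v))
    (bound := fun θ => ‖k θ‖ * C) hball
    (Filter.eventually_of_mem hball fun x hx => (hcont x hx).aestronglyMeasurable)
    ((hcont x₀ hx₀').intervalIntegrable _ _) ?_ ?_ ?_ ?_
  · refine (DifferentiableAt.congr_of_eventuallyEq ?_
      (Filter.eventually_of_mem hball hrep)).differentiableWithinAt
    exact hint.differentiableAt.const_mul _
  · borelize E
    borelize (E →L[ℂ] ℂ)
    have := continuous_circleMap 0 ρ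
    refine AEMeasurable.aestronglyMeasurable (Measurable.aemeasurable ?_)
    refine hkc.measurable.smul ((measurable_fderiv ℂ f).comp (Continuous.measurable ?_))
    fun_prop
  · refine Filter.Eventually.of_forall fun θ _ x hx => ?_
    rw [norm_smul]
    exact mul_le_mul_of_nonneg_left (hC _ (hmem x hx _ (hcirc θ))) (norm_nonneg _)
  · exact (hkc.norm.mul continuous_const).intervalIntegrable _ _
  · refine Filter.Eventually.of_forall fun θ _ x hx => ?_
    have hd := (hf.differentiableAt
      (hU.mem_nhds (hRU (hmem x hx _ (hcirc θ))))).hasFDerivAt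
    exact ((hasFDerivAt_comp_add_right _).2 hd).const_mul (k θ)

/-- A complex Fréchet differentiable function on an open subset of a finite-dimensional space
is infinitely differentiable. -/
theorem DifferentiableOn.contDiffOn_of_finiteDimensional [FiniteDimensional ℂ E] {U : Set E}
    (hU : IsOpen U) (n : ℕ) {f : E → ℂ} (hf : DifferentiableOn ℂ f U) :
    ContDiffOn ℂ n f U := by
  induction n generalizing f with
  | zero => exact contDiffOn_zero.2 hf.continuousOn
  | succ n ih =>
    rw [Nat.cast_add, Nat.cast_one, contDiffOn_succ_iff_fderiv_of_isOpen hU]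
    exact ⟨hf, fun h => by simp at h,
      contDiffOn_clm_apply.2 fun v => ih (differentiableOn_fderiv_apply_const hU hf v)⟩

end HolomorphicSmooth

section ThirdDerivative

open Topology

variable {E : Type*} [NormedAddCommGroup E] [NormedSpace ℂ E]

theorem iteratedFDeriv_three_swap_left {F : E → ℂ} {t : E} (hF : ContDiffAt ℂ 3 F t)
    (u v w : E) :
    iteratedFDeriv ℂ 3 F t ![u, v, w] = iteratedFDeriv ℂ 3 F t ![v, u, w] := by
  have h : ContDiffAt ℂ 2 (fderiv ℂ F) t := hF.fderiv_right (by norm_num)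
  have hs := h.isSymmSndFDerivAt (by simp)
  rw [iteratedFDeriv_succ_apply_right (n := 2), iteratedFDeriv_succ_apply_right (n := 2),
    iteratedFDeriv_two_apply, iteratedFDeriv_two_apply]
  exact congrArg (fun L : E →L[ℂ] ℂ => L w) (hs u v)

theorem iteratedFDeriv_three_swap_right {F : E → ℂ} {t : E} (hF : ContDiffAt ℂ 3 F t)
    (u v w : E) :
    iteratedFDeriv ℂ 3 F t ![u, v, w] = iteratedFDeriv ℂ 3 F t ![u, w, v] := by
  have hd : DifferentiableAt ℂ (iteratedFDeriv ℂ 2 F) t :=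
    hF.differentiableAt_iteratedFDeriv (by norm_num)
  have key : ∀ m : Fin 2 → E, fderiv ℂ (iteratedFDeriv ℂ 2 F) t u m =
      fderiv ℂ (fun y => iteratedFDeriv ℂ 2 F y m) t u := fun m => by
    rw [fderiv_continuousMultilinear_apply_const_apply hd]
  have he : (fun y => iteratedFDeriv ℂ 2 F y ![v, w]) =ᶠ[𝓝 t]
      fun y => iteratedFDeriv ℂ 2 F y ![w, v] := by
    filter_upwards [hF.eventually (by simp)] with y hy
    rw [iteratedFDeriv_two_apply, iteratedFDeriv_two_apply]
    exact hy.isSymmSndFDerivAt (by simp; norm_num) v w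
  rw [iteratedFDeriv_succ_apply_left, iteratedFDeriv_succ_apply_left]
  change fderiv ℂ (iteratedFDeriv ℂ 2 F) t u ![v, w] = fderiv ℂ (iteratedFDeriv ℂ 2 F) t u ![w, v]
  rw [key, key, he.fderiv_eq]

/-- A symmetric trilinear form is determined by its diagonal. -/
theorem ContinuousMultilinearMap.eq_zero_of_diagonal_three
    (M : ContinuousMultilinearMap ℂ (fun _ : Fin 3 => E) ℂ)
    (hl : ∀ u v w, M ![u, v, w] = M ![v, u, w]) (hr : ∀ u v w, M ![u, v, w] = M ![u, w, v])
    (hM : ∀ u, M ![u, u, u] = 0) (u v w : E) : M ![u, v, w] = 0 := by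
  have add₁ : ∀ a b v w, M ![a + b, v, w] = M ![a, v, w] + M ![b, v, w] := fun a b v w =>
    M.toMultilinearMap.cons_add ![v, w] a b
  have add₂ : ∀ a b v w, M ![v, a + b, w] = M ![v, a, w] + M ![v, b, w] := fun a b v w => by
    rw [hl, add₁, hl, hl b]
  have add₃ : ∀ a b v w, M ![v, w, a + b] = M ![v, w, a] + M ![v, w, b] := fun a b v w => by
    rw [hr, add₂, hr, hr _ b]
  have huuv : ∀ u v, M ![u, u, v] = 0 := by
    intro u v
    have h1 := hM (u + v)
    have h2 := hM (u + v + v)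
    simp only [add₁, add₂, add₃, hM, hr u v u, hl v u, hr v v u] at h1 h2
    linear_combination (2 * h1 - h2 / 2) / 3
  have h := huuv (u + v) w
  simp only [add₁, add₂, huuv, hl v u] at h
  linear_combination h / 2

theorem iteratedFDeriv_diagonal {F : E → ℂ} {t : E} (n : ℕ) (hF : ContDiffAt ℂ n F t) (v : E) :
    iteratedFDeriv ℂ n F t (fun _ => v) = iteratedDeriv n (fun z : ℂ => F (t + z • v)) 0 := by
  obtain ⟨s, hs, hFs⟩ : ∃ s ∈ 𝓝 t, ContDiffOn ℂ n F s := hF.contDiffOn le_rfl (by simp)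
  obtain ⟨s', hs's, ho, hts⟩ := mem_nhds_iff.1 hs
  set g : ℂ →L[ℂ] E := ContinuousLinearMap.toSpanSingleton ℂ v
  have hG : ContDiffOn ℂ n (fun y => F (t + y)) ((fun y => t + y) ⁻¹' s') :=
    (hFs.mono hs's).comp (by fun_prop) fun y hy => hy
  have ho' : IsOpen ((fun y => t + y) ⁻¹' s') := ho.preimage (by fun_prop)
  have ho'' : IsOpen (g ⁻¹' ((fun y => t + y) ⁻¹' s')) := ho'.preimage g.continuous
  have h0 : g 0 ∈ (fun y => t + y) ⁻¹' s' := by simpa using hts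
  have h := g.iteratedFDerivWithin_comp_right hG ho'.uniqueDiffOn ho''.uniqueDiffOn h0 le_rfl
  rw [iteratedFDerivWithin_of_isOpen n ho'' h0, iteratedFDerivWithin_of_isOpen n ho' h0,
    iteratedFDeriv_comp_add_left] at h
  have h2 := congrArg (fun L => L fun _ => (1 : ℂ)) h
  simp only [ContinuousMultilinearMap.compContinuousLinearMap_apply] at h2
  rw [iteratedDeriv_eq_iteratedFDeriv]
  simp only [map_zero, add_zero, g, ContinuousLinearMap.toSpanSingleton_apply, one_smul] at h2
  exact h2.symm

theorem iteratedDeriv_three_of_eventuallyEq {f r : ℂ → ℂ} {A B C : ℂ} (hr : AnalyticAt ℂ r 0)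
    (hf : ∀ᶠ z in 𝓝 0, f z = A + B * z + C * z ^ 2 + z ^ 3 * r z) :
    iteratedDeriv 3 f 0 = 6 * r 0 := by
  have hp : AnalyticAt ℂ (fun z : ℂ => z ^ 3) 0 := by fun_prop
  have hf' : f =ᶠ[𝓝 0] fun z => (A + (B * z ^ 1 + C * z ^ 2)) + z ^ 3 * r z := by
    filter_upwards [hf] with z hz
    rw [hz]; ring
  have hq : AnalyticAt ℂ (fun z : ℂ => A + (B * z ^ 1 + C * z ^ 2)) 0 := by fun_prop
  rw [hf'.iteratedDeriv_eq, iteratedDeriv_fun_add hq.contDiffAt (hp.fun_mul hr).contDiffAt,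
    iteratedDeriv_fun_mul hp.contDiffAt hr.contDiffAt, iteratedDeriv_const_add (by norm_num),
    iteratedDeriv_fun_add (by fun_prop) (by fun_prop)]
  simp only [iteratedDeriv_const_mul_field, iteratedDeriv_fun_pow_zero]
  simp [Nat.factorial]

theorem exists_taylor_three {h : ℂ → ℂ} (hh : AnalyticAt ℂ h 0) :
    ∃ (A B C : ℂ) (r : ℂ → ℂ), AnalyticAt ℂ r 0 ∧
      ∀ z, h z = A + B * z + C * z ^ 2 + z ^ 3 * r z := by
  obtain ⟨r, hr, hr'⟩ := hh.exists_eq_sum_add_pow_mul 3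
  refine ⟨h 0, deriv h 0, iteratedDeriv 2 h 0 / 2, r, hr, fun z => ?_⟩
  rw [hr' z]
  simp only [Finset.sum_range_succ, Finset.sum_range_zero, smul_eq_mul]
  simp [Nat.factorial]
  ring

end ThirdDerivative

section Pairing

variable {n : ℕ}

/-- The polarization of `midSum`. -/
noncomputable def midPair (u v : Fin n → ℂ) : ℂ :=
  ∑ i : Fin n, if 1 ≤ (i : ℕ) ∧ (i : ℕ) ≤ n - 2 then u i * v i.rev else 0

theorem midSum_eq_midPair (hn : 2 ≤ n) (t : Fin n → ℂ) : midSum n hn t = midPair t t := by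
  refine Finset.sum_congr rfl fun i _ => ?_
  have : (⟨n - 1 - (i : ℕ), by omega⟩ : Fin n) = i.rev := by
    ext; simp only [Fin.val_rev]; omega
  rw [this]

theorem midPair_comm (u v : Fin n → ℂ) : midPair u v = midPair v u := by
  unfold midPair
  rw [← Equiv.sum_comp Fin.revPerm]
  refine Finset.sum_congr rfl fun i _ => ?_
  have h : (1 ≤ (i.rev : ℕ) ∧ (i.rev : ℕ) ≤ n - 2) ↔ (1 ≤ (i : ℕ) ∧ (i : ℕ) ≤ n - 2) := by
    rw [Fin.val_rev]; omega
  simp only [Fin.revPerm_apply, h, Fin.rev_rev, mul_comm]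

theorem midPair_add_left (u u' v : Fin n → ℂ) :
    midPair (u + u') v = midPair u v + midPair u' v := by
  simp only [midPair, ← Finset.sum_add_distrib]
  refine Finset.sum_congr rfl fun i _ => ?_
  split_ifs
  · simp only [Pi.add_apply]; ring
  · simp

theorem midPair_smul_left (z : ℂ) (u v : Fin n → ℂ) : midPair (z • u) v = z * midPair u v := by
  simp only [midPair, Finset.mul_sum]
  refine Finset.sum_congr rfl fun i _ => ?_
  split_ifs
  · simp only [Pi.smul_apply, smul_eq_mul]; ring
  · simp

theorem midPair_add_right (u v v' : Fin n → ℂ) :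
    midPair u (v + v') = midPair u v + midPair u v' := by
  rw [midPair_comm, midPair_add_left, midPair_comm v, midPair_comm v']

theorem midPair_smul_right (z : ℂ) (u v : Fin n → ℂ) : midPair u (z • v) = z * midPair u v := by
  rw [midPair_comm, midPair_smul_left, midPair_comm]

theorem midPair_congr {u u' v v' : Fin n → ℂ}
    (hu : ∀ i : Fin n, 1 ≤ (i : ℕ) → (i : ℕ) ≤ n - 2 → u i = u' i)
    (hv : ∀ i : Fin n, 1 ≤ (i : ℕ) → (i : ℕ) ≤ n - 2 → v i = v' i) :
    midPair u v = midPair u' v' := by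
  refine Finset.sum_congr rfl fun i _ => ?_
  split_ifs with h
  · rw [hu i h.1 h.2, hv i.rev (by rw [Fin.val_rev]; omega) (by rw [Fin.val_rev]; omega)]
  · rfl

theorem sum_mul_rev_eq_midPair (hn : 2 ≤ n) (u v : Fin n → ℂ) :
    ∑ p, u p * v p.rev = u ⟨0, by omega⟩ * v (lastIdx n hn) + u (lastIdx n hn) * v ⟨0, by omega⟩
      + midPair u v := by
  have h : ∀ p : Fin n, u p * v p.rev =
      (if p = ⟨0, by omega⟩ then u ⟨0, by omega⟩ * v (lastIdx n hn) else 0)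
      + (if p = lastIdx n hn then u (lastIdx n hn) * v ⟨0, by omega⟩ else 0)
      + (if 1 ≤ (p : ℕ) ∧ (p : ℕ) ≤ n - 2 then u p * v p.rev else 0) := by
    intro p
    by_cases h0 : p = ⟨0, by omega⟩
    · subst h0
      have h1 : (⟨0, by omega⟩ : Fin n) ≠ lastIdx n hn := by
        simp only [lastIdx, ne_eq, Fin.mk.injEq]; omega
      have h2 : (⟨0, by omega⟩ : Fin n).rev = lastIdx n hn := by
        ext; simp [lastIdx, Fin.val_rev]
      simp [h1, h2]
    by_cases h1 : p = lastIdx n hn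
    · subst h1
      have h2 : (lastIdx n hn).rev = ⟨0, by omega⟩ := by
        ext; simp only [lastIdx, Fin.val_rev]; omega
      have h3 : ¬ ((lastIdx n hn : Fin n) : ℕ) ≤ n - 2 := by
        simp only [lastIdx]; omega
      simp [h0, h2, h3]
    · have h2 : 1 ≤ (p : ℕ) ∧ (p : ℕ) ≤ n - 2 := by
        have hp := p.isLt
        simp only [lastIdx, Fin.ext_iff] at h0 h1; omega
      simp [h0, h1, h2]
  rw [Finset.sum_congr rfl fun p _ => h p]
  simp [Finset.sum_add_distrib, midPair]

/-- The differential at `s` of the change of coordinates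
`s ↦ (s¹ + c S(s) / (2 w), s² / w, …, sⁿ⁻¹ / w, (a sⁿ + b) / w)`, where `w = c sⁿ + d`,
`S = midSum` and `a d - b c = 1`. -/
noncomputable def slJacobian (n : ℕ) (hn : 2 ≤ n) (c w : ℂ) (s : Fin n → ℂ) :
    (Fin n → ℂ) →ₗ[ℂ] (Fin n → ℂ) where
  toFun u i :=
    if i = ⟨0, by omega⟩ then
      u ⟨0, by omega⟩ + c / w * midPair s u
        - c ^ 2 / (2 * w ^ 2) * midPair s s * u (lastIdx n hn)
    else if i = lastIdx n hn then u (lastIdx n hn) / w ^ 2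
    else u i / w - c * u (lastIdx n hn) / w ^ 2 * s i
  map_add' u v := by
    ext i
    simp only [Pi.add_apply, midPair_add_right]
    split_ifs <;> ring
  map_smul' z u := by
    ext i
    simp only [Pi.smul_apply, midPair_smul_right, smul_eq_mul, RingHom.id_apply]
    split_ifs <;> ring

variable (hn : 2 ≤ n) (c w : ℂ) (s : Fin n → ℂ)

theorem slJacobian_zero (u : Fin n → ℂ) : slJacobian n hn c w s u ⟨0, by omega⟩ =
    u ⟨0, by omega⟩ + c / w * midPair s u
      - c ^ 2 / (2 * w ^ 2) * midPair s s * u (lastIdx n hn) := by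
  simp [slJacobian]

theorem slJacobian_last (u : Fin n → ℂ) :
    slJacobian n hn c w s u (lastIdx n hn) = u (lastIdx n hn) / w ^ 2 := by
  have h1 : lastIdx n hn ≠ (⟨0, by omega⟩ : Fin n) := by
    simp only [lastIdx, ne_eq, Fin.mk.injEq]; omega
  simp [slJacobian, h1]

theorem slJacobian_mid (u : Fin n → ℂ) (i : Fin n) (h : 1 ≤ (i : ℕ)) (h' : (i : ℕ) ≤ n - 2) :
    slJacobian n hn c w s u i = u i / w - c * u (lastIdx n hn) / w ^ 2 * s i := by
  have h1 : i ≠ (⟨0, by omega⟩ : Fin n) := by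
    simp only [ne_eq, Fin.ext_iff]; omega
  have h2 : i ≠ lastIdx n hn := by
    simp only [lastIdx, ne_eq, Fin.ext_iff]; omega
  simp [slJacobian, h1, h2]

theorem midPair_slJacobian (u v : Fin n → ℂ) :
    midPair (slJacobian n hn c w s u) (slJacobian n hn c w s v) =
      w⁻¹ ^ 2 * midPair u v - c * w⁻¹ ^ 3 * u (lastIdx n hn) * midPair s v
      - c * w⁻¹ ^ 3 * v (lastIdx n hn) * midPair s u
      + c ^ 2 * w⁻¹ ^ 4 * u (lastIdx n hn) * v (lastIdx n hn) * midPair s s := by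
  have h : ∀ u : Fin n → ℂ, ∀ i : Fin n, 1 ≤ (i : ℕ) → (i : ℕ) ≤ n - 2 →
      slJacobian n hn c w s u i = (w⁻¹ • u + (-(c * u (lastIdx n hn) * w⁻¹ ^ 2)) • s) i := by
    intro u i h h'
    rw [slJacobian_mid hn c w s u i h h']
    simp only [Pi.add_apply, Pi.smul_apply, smul_eq_mul, div_eq_mul_inv]
    ring
  rw [midPair_congr (h u) (h v)]
  simp only [midPair_add_left, midPair_add_right, midPair_smul_left, midPair_smul_right,
    midPair_comm u s]
  ring

theorem sum_slJacobian_mul_rev (hw : w ≠ 0) (u v : Fin n → ℂ) :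
    ∑ p, slJacobian n hn c w s u p * slJacobian n hn c w s v p.rev =
      w⁻¹ ^ 2 * ∑ p, u p * v p.rev := by
  rw [sum_mul_rev_eq_midPair hn, sum_mul_rev_eq_midPair hn, midPair_slJacobian]
  simp only [slJacobian_zero, slJacobian_last]
  field_simp
  ring

/-- A conformal endomorphism of the pairing `∑ₚ uₚ v_{rev p}` also rescales the dual pairing. -/
theorem sum_apply_single_mul_rev {μ : ℂ} (hμ : μ ≠ 0) (J : (Fin n → ℂ) →ₗ[ℂ] (Fin n → ℂ))
    (hJ : ∀ u v, ∑ p, J u p * J v p.rev = μ * ∑ p, u p * v p.rev)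
    (f g : (Fin n → ℂ) →ₗ[ℂ] ℂ) :
    ∑ p : Fin n, f (J (Pi.single p 1)) * g (J (Pi.single p.rev 1)) =
      μ * ∑ p : Fin n, f (Pi.single p 1) * g (Pi.single p.rev 1) := by
  set A : Matrix (Fin n) (Fin n) ℂ := LinearMap.toMatrix' J with hA
  set B : Matrix (Fin n) (Fin n) ℂ := Matrix.of fun p q => μ⁻¹ * A q.rev p.rev with hB
  have hAJ : ∀ p q, A q p = J (Pi.single p 1) q := fun p q => by
    rw [hA, LinearMap.toMatrix'_apply]
  have hBA : B * A = 1 := by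
    ext i j
    have h := hJ (Pi.single i.rev 1) (Pi.single j 1)
    rw [Matrix.mul_apply, ← Equiv.sum_comp Fin.revPerm]
    simp only [hB, Matrix.of_apply, hAJ, Fin.revPerm_apply, Fin.rev_rev, mul_assoc,
      ← Finset.mul_sum]
    rw [h]
    by_cases hij : i = j
    · simp [Pi.single_apply, Matrix.one_apply, hμ, Fin.rev_eq_iff, hij]
    · simp [Pi.single_apply, Fin.rev_eq_iff, hij, Ne.symm hij]
  have hAB : A * B = 1 := mul_eq_one_comm.1 hBA
  have hentry : ∀ i j : Fin n, ∑ p : Fin n, A i p * A j.rev p.rev = μ * if i = j then 1 else 0 := by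
    intro i j
    have h := congrFun (congrFun hAB i) j
    rw [Matrix.mul_apply, Matrix.one_apply] at h
    rw [← h, Finset.mul_sum]
    refine Finset.sum_congr rfl fun p _ => ?_
    rw [hB, Matrix.of_apply]
    field_simp
  have hf : ∀ (f : (Fin n → ℂ) →ₗ[ℂ] ℂ) (p : Fin n), f (J (Pi.single p 1)) =
      ∑ i, A i p * f (Pi.single i 1) := fun f p => by
    rw [LinearMap.pi_apply_eq_sum_univ f]
    refine Finset.sum_congr rfl fun i _ => ?_
    rw [hAJ, smul_eq_mul]
    congr 2
    ext j
    simp [Pi.single_apply, eq_comm]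
  have hg : ∀ p : Fin n, g (J (Pi.single p.rev 1)) =
      ∑ j : Fin n, A j.rev p.rev * g (Pi.single j.rev 1) := fun p => by
    rw [hf, ← Equiv.sum_comp Fin.revPerm]
    rfl
  calc ∑ p : Fin n, f (J (Pi.single p 1)) * g (J (Pi.single p.rev 1))
      = ∑ p : Fin n, ∑ i : Fin n, ∑ j : Fin n, (A i p * A j.rev p.rev) *
          (f (Pi.single i 1) * g (Pi.single j.rev 1)) := by
        refine Finset.sum_congr rfl fun p _ => ?_
        rw [hf, hg, Finset.sum_mul_sum]
        exact Finset.sum_congr rfl fun i _ => Finset.sum_congr rfl fun j _ => by ring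
    _ = ∑ i : Fin n, ∑ j : Fin n, (∑ p : Fin n, A i p * A j.rev p.rev) *
          (f (Pi.single i 1) * g (Pi.single j.rev 1)) := by
        rw [Finset.sum_comm]
        refine Finset.sum_congr rfl fun i _ => ?_
        rw [Finset.sum_comm]
        exact Finset.sum_congr rfl fun j _ => by rw [Finset.sum_mul]
    _ = μ * ∑ p : Fin n, f (Pi.single p 1) * g (Pi.single p.rev 1) := by
        rw [Finset.mul_sum]
        refine Finset.sum_congr rfl fun i _ => ?_
        simp [hentry]

end Pairing

section Potential

open Topology

variable {n : ℕ}

theorem sum_sum_antidiagonal_eq (f g : Fin n → ℂ) :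
    (∑ p : Fin n, ∑ q : Fin n, if (p : ℕ) + (q : ℕ) = n - 1 then f p * g q else 0) =
      ∑ p : Fin n, f p * g p.rev := by
  refine Finset.sum_congr rfl fun p _ => ?_
  rw [Finset.sum_eq_single p.rev]
  · rw [if_pos]; rw [Fin.val_rev]; omega
  · intro q _ hq
    refine if_neg fun h => hq ?_
    ext; rw [Fin.val_rev]; omega
  · simp

theorem contDiffAt_midSum (hn : 2 ≤ n) (t : Fin n → ℂ) : ContDiffAt ℂ 3 (midSum n hn) t := by
  refine ContDiffAt.sum fun i _ => ?_
  split_ifs <;> fun_prop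

theorem contDiffAt_stdForm (hn : 2 ≤ n) {H : (Fin (n - 1) → ℂ) → ℂ} {t : Fin n → ℂ}
    (hH : ContDiffAt ℂ 3 H (tailArg t)) : ContDiffAt ℂ 3 (stdForm n hn H) t := by
  have h : ContDiffAt ℂ 3 (fun t : Fin n → ℂ => H (tailArg t)) t :=
    ContDiffAt.comp t hH (by unfold tailArg; fun_prop)
  exact (ContDiffAt.add (by fun_prop)
    (ContDiffAt.mul (by fun_prop) (contDiffAt_midSum hn t))).add h

theorem contDiffAt_slPotential (hn : 2 ≤ n) {H : (Fin (n - 1) → ℂ) → ℂ} {a b c d : ℂ}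
    {t : Fin n → ℂ} (ht : c * t (lastIdx n hn) + d ≠ 0)
    (hH : ContDiffAt ℂ 3 H (mobiusArg n hn a b c d t)) :
    ContDiffAt ℂ 3 (slPotential n hn a b c d H) t := by
  have hmob : ContDiffAt ℂ 3 (mobiusArg n hn a b c d) t := by
    refine contDiffAt_pi.2 fun j => ?_
    unfold mobiusArg
    split_ifs
    · exact ContDiffAt.div (by fun_prop) (by fun_prop) ht
    · exact ContDiffAt.div (by fun_prop) (by fun_prop) ht
  have h : ContDiffAt ℂ 3 (fun t : Fin n → ℂ => H (mobiusArg n hn a b c d t)) t :=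
    ContDiffAt.comp t hH hmob
  have hm := contDiffAt_midSum hn t
  have hdiv : ContDiffAt ℂ 3 (fun t : Fin n → ℂ => c / (8 * (c * t (lastIdx n hn) + d))) t :=
    ContDiffAt.div (by fun_prop) (by fun_prop) (mul_ne_zero (by norm_num) ht)
  unfold slPotential
  fun_prop

/-- A point of `ℂⁿ` whose tail is the given point of `ℂⁿ⁻¹`. -/
def consZero (x : Fin (n - 1) → ℂ) : Fin n → ℂ :=
  fun i => if h : (i : ℕ) = 0 then 0 else x ⟨(i : ℕ) - 1, by omega⟩

theorem tailArg_consZero (x : Fin (n - 1) → ℂ) : tailArg (consZero x) = x := by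
  ext j
  simp [tailArg, consZero]

/-- Affine lines are mapped to affine lines, with a projective reparametrization. -/
theorem mobiusArg_add_smul (hn : 2 ≤ n) {a b c d : ℂ} (hA : a * d - b * c = 1)
    {s : Fin n → ℂ} (u : Fin n → ℂ) (z : ℂ) (hs : c * s (lastIdx n hn) + d ≠ 0)
    (hz : c * s (lastIdx n hn) + d + c * u (lastIdx n hn) * z ≠ 0) :
    mobiusArg n hn a b c d (s + z • u) =
      mobiusArg n hn a b c d s +
        (z * (c * s (lastIdx n hn) + d) / (c * s (lastIdx n hn) + d + c * u (lastIdx n hn) * z)) •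
          tailArg (slJacobian n hn c (c * s (lastIdx n hn) + d) s u) := by
  have hden : c * (s (lastIdx n hn) + z * u (lastIdx n hn)) + d =
      c * s (lastIdx n hn) + d + c * u (lastIdx n hn) * z := by ring
  obtain ⟨w, hw⟩ : ∃ w, w = c * s (lastIdx n hn) + d := ⟨_, rfl⟩
  obtain ⟨k, hk⟩ : ∃ k, k = w + c * u (lastIdx n hn) * z := ⟨_, rfl⟩
  ext j
  have hj := j.isLt
  simp only [mobiusArg, Pi.add_apply, Pi.smul_apply, smul_eq_mul, tailArg, hden]
  rw [← hw, ← hk] at hz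
  rw [← hw] at hs
  rw [← hw, ← hk]
  split_ifs with h
  · have hl : (⟨(j : ℕ) + 1, by omega⟩ : Fin n) = lastIdx n hn := by
      ext; simp only [lastIdx]; omega
    rw [hl, slJacobian_last]
    field_simp
    rw [hk, hw]
    linear_combination (z * u (lastIdx n hn)) * hA
  · rw [slJacobian_mid hn c _ s u _ (by simp) (by simp only; omega)]
    field_simp
    rw [hk]
    ring

theorem tailArg_add_smul (t v : Fin n → ℂ) (z : ℂ) :
    tailArg (t + z • v) = tailArg t + z • tailArg v := rfl

theorem midSum_add_smul (hn : 2 ≤ n) (t v : Fin n → ℂ) (z : ℂ) :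
    midSum n hn (t + z • v) = midPair t t + 2 * midPair t v * z + midPair v v * z ^ 2 := by
  rw [midSum_eq_midPair]
  simp only [midPair_add_left, midPair_add_right, midPair_smul_left, midPair_smul_right,
    midPair_comm v t]
  ring

/-- The third derivatives of `stdForm` and `slPotential` agree on the diagonal, up to the
differential of the change of coordinates. -/
theorem iteratedFDeriv_three_slPotential_diagonal (hn : 2 ≤ n) {H : (Fin (n - 1) → ℂ) → ℂ}
    {a b c d : ℂ} (hA : a * d - b * c = 1) {s : Fin n → ℂ}
    (hs : c * s (lastIdx n hn) + d ≠ 0)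
    (hH : ∀ᶠ x in 𝓝 (mobiusArg n hn a b c d s), DifferentiableAt ℂ H x)
    (hH3 : ContDiffAt ℂ 3 H (mobiusArg n hn a b c d s)) (u : Fin n → ℂ) :
    iteratedFDeriv ℂ 3 (slPotential n hn a b c d H) s (fun _ => u) =
      (c * s (lastIdx n hn) + d) ^ 2 *
        iteratedFDeriv ℂ 3 (stdForm n hn H) (consZero (mobiusArg n hn a b c d s))
          (fun _ => slJacobian n hn c (c * s (lastIdx n hn) + d) s u) := by
  have hP := tailArg_consZero (mobiusArg n hn a b c d s)
  have hmob := mobiusArg_add_smul hn hA (s := s) u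
  rw [iteratedFDeriv_diagonal 3 (contDiffAt_slPotential hn hs hH3),
    iteratedFDeriv_diagonal 3 (contDiffAt_stdForm hn (by rwa [hP]))]
  set w : ℂ := c * s (lastIdx n hn) + d with hw
  set v := slJacobian n hn c w s u with hv
  set P := consZero (mobiusArg n hn a b c d s)
  obtain ⟨h₀, h₁, h₂, r, hr, hh⟩ : ∃ (A B C : ℂ) (r : ℂ → ℂ), AnalyticAt ℂ r 0 ∧
      ∀ z : ℂ, H (mobiusArg n hn a b c d s + z • tailArg v) =
        A + B * z + C * z ^ 2 + z ^ 3 * r z := by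
    refine exists_taylor_three (Complex.analyticAt_iff_eventually_differentiableAt.2 ?_)
    have hl : ContinuousAt (fun z : ℂ => mobiusArg n hn a b c d s + z • tailArg v) 0 := by
      fun_prop
    have hl0 : Filter.Tendsto (fun z : ℂ => mobiusArg n hn a b c d s + z • tailArg v) (𝓝 0)
        (𝓝 (mobiusArg n hn a b c d s)) := by
      simpa using hl.tendsto
    filter_upwards [hl0.eventually hH] with z hz
    exact DifferentiableAt.comp z hz (by fun_prop)
  set e := c * u (lastIdx n hn) with he
  have hstd := iteratedDeriv_three_of_eventuallyEq
    (f := fun z : ℂ => stdForm n hn H (P + z • v))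
    (A := 1 / 2 * P ⟨0, by omega⟩ ^ 2 * P (lastIdx n hn)
      + 1 / 2 * P ⟨0, by omega⟩ * midPair P P + h₀)
    (B := P ⟨0, by omega⟩ * v ⟨0, by omega⟩ * P (lastIdx n hn)
      + 1 / 2 * P ⟨0, by omega⟩ ^ 2 * v (lastIdx n hn)
      + 1 / 2 * v ⟨0, by omega⟩ * midPair P P + P ⟨0, by omega⟩ * midPair P v + h₁)
    (C := 1 / 2 * v ⟨0, by omega⟩ ^ 2 * P (lastIdx n hn)
      + P ⟨0, by omega⟩ * v ⟨0, by omega⟩ * v (lastIdx n hn)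
      + v ⟨0, by omega⟩ * midPair P v + 1 / 2 * P ⟨0, by omega⟩ * midPair v v + h₂)
    (r := fun z => 1 / 2 * v ⟨0, by omega⟩ ^ 2 * v (lastIdx n hn)
      + 1 / 2 * v ⟨0, by omega⟩ * midPair v v + r z) (by fun_prop)
    (Filter.Eventually.of_forall fun z => by
      simp only [stdForm, tailArg_add_smul, hP, hh, midSum_add_smul, Pi.add_apply, Pi.smul_apply,
        smul_eq_mul]
      ring)
  have hwz : ∀ᶠ z : ℂ in 𝓝 0, w + e * z ≠ 0 := by
    have hc : ContinuousAt (fun z : ℂ => w + e * z) 0 := by fun_prop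
    exact hc.eventually_ne (by simpa using hs)
  have hrz : AnalyticAt ℂ (fun z : ℂ => r (z * w / (w + e * z))) 0 := by
    have hin : AnalyticAt ℂ (fun z : ℂ => z * w / (w + e * z)) 0 :=
      AnalyticAt.fun_div (by fun_prop) (by fun_prop) (by simpa using hs)
    exact AnalyticAt.fun_comp (by simpa using hr) hin
  have hinv : AnalyticAt ℂ (fun z : ℂ => (w + e * z)⁻¹) 0 :=
    AnalyticAt.fun_inv (by fun_prop) (by simpa using hs)
  set m₀ := midPair s s with hm₀
  set m₁ := midPair s u with hm₁
  set m₂ := midPair u u with hm₂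
  set q₀ := m₀ ^ 2 / w with hq₀
  set q₁ := (4 * m₀ * m₁ - e * q₀) / w with hq₁
  set q₂ := (4 * m₁ ^ 2 + 2 * m₀ * m₂ - e * q₁) / w with hq₂
  have hsl := iteratedDeriv_three_of_eventuallyEq
    (f := fun z : ℂ => slPotential n hn a b c d H (s + z • u))
    (A := 1 / 2 * s ⟨0, by omega⟩ ^ 2 * s (lastIdx n hn)
      + 1 / 2 * s ⟨0, by omega⟩ * m₀ + c / 8 * q₀ + w ^ 2 * h₀)
    (B := s ⟨0, by omega⟩ * u ⟨0, by omega⟩ * s (lastIdx n hn)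
      + 1 / 2 * s ⟨0, by omega⟩ ^ 2 * u (lastIdx n hn)
      + 1 / 2 * u ⟨0, by omega⟩ * m₀ + s ⟨0, by omega⟩ * m₁ + c / 8 * q₁
      + 2 * w * e * h₀ + w ^ 2 * h₁)
    (C := 1 / 2 * u ⟨0, by omega⟩ ^ 2 * s (lastIdx n hn)
      + s ⟨0, by omega⟩ * u ⟨0, by omega⟩ * u (lastIdx n hn)
      + u ⟨0, by omega⟩ * m₁ + 1 / 2 * s ⟨0, by omega⟩ * m₂ + c / 8 * q₂
      + e ^ 2 * h₀ + e * w * h₁ + w ^ 2 * h₂)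
    (r := fun z => 1 / 2 * u ⟨0, by omega⟩ ^ 2 * u (lastIdx n hn)
      + 1 / 2 * u ⟨0, by omega⟩ * m₂
      + c / 8 * (4 * m₁ * m₂ - e * q₂ + m₂ ^ 2 * z) * (w + e * z)⁻¹
      + w ^ 3 * (w + e * z)⁻¹ * r (z * w / (w + e * z)))
    ((AnalyticAt.fun_add (by fun_prop) (AnalyticAt.fun_mul (by fun_prop) hinv)).fun_add
      ((analyticAt_const.fun_mul hinv).fun_mul hrz))
    (by
      filter_upwards [hwz] with z hz
      have hden : c * (s (lastIdx n hn) + z * u (lastIdx n hn)) + d = w + e * z := by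
        rw [hw, he]; ring
      simp only [slPotential, hmob z hs hz, hh, midSum_add_smul, Pi.add_apply, Pi.smul_apply,
        smul_eq_mul, hden, ← hm₀, ← hm₁, ← hm₂]
      have hK : c / (8 * (w + e * z)) * (m₀ + 2 * m₁ * z + m₂ * z ^ 2) ^ 2 =
          c / 8 * (q₀ + q₁ * z + q₂ * z ^ 2)
          + z ^ 3 * (c / 8 * (4 * m₁ * m₂ - e * q₂ + m₂ ^ 2 * z) * (w + e * z)⁻¹) := by
        rw [hq₂, hq₁, hq₀]
        field_simp
        ring
      rw [hK]
      generalize r (z * w / (w + e * z)) = ρ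
      obtain ⟨k, hk⟩ : ∃ k, k = w + e * z := ⟨_, rfl⟩
      rw [← hk] at hz ⊢
      rw [div_eq_mul_inv (z * w) k]
      have hH2 : k ^ 2 * (h₀ + h₁ * (z * w * k⁻¹) + h₂ * (z * w * k⁻¹) ^ 2
          + (z * w * k⁻¹) ^ 3 * ρ) =
          k ^ 2 * h₀ + h₁ * (z * w * k) + h₂ * (z * w) ^ 2 + (z * w) ^ 3 * k⁻¹ * ρ := by
        field_simp
      rw [hH2, hk]
      ring)
  rw [hsl, hstd]
  simp only [zero_mul, zero_div, mul_zero, add_zero]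
  rw [hv, midPair_slJacobian, slJacobian_zero, slJacobian_last, ← hm₀, ← hm₁, ← hm₂, hq₂, hq₁, hq₀,
    he]
  field_simp
  ring

/-- The third derivatives of `slPotential` and `stdForm` agree, up to the differential of the
change of coordinates. -/
theorem iteratedFDeriv_three_slPotential (hn : 2 ≤ n) {H : (Fin (n - 1) → ℂ) → ℂ}
    {a b c d : ℂ} (hA : a * d - b * c = 1) {s : Fin n → ℂ}
    (hs : c * s (lastIdx n hn) + d ≠ 0)
    (hH : ∀ᶠ x in 𝓝 (mobiusArg n hn a b c d s), DifferentiableAt ℂ H x)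
    (hH3 : ContDiffAt ℂ 3 H (mobiusArg n hn a b c d s)) (u v x : Fin n → ℂ) :
    iteratedFDeriv ℂ 3 (slPotential n hn a b c d H) s ![u, v, x] =
      (c * s (lastIdx n hn) + d) ^ 2 *
        iteratedFDeriv ℂ 3 (stdForm n hn H) (consZero (mobiusArg n hn a b c d s))
          ![slJacobian n hn c (c * s (lastIdx n hn) + d) s u,
            slJacobian n hn c (c * s (lastIdx n hn) + d) s v,
            slJacobian n hn c (c * s (lastIdx n hn) + d) s x] := by
  have hF := contDiffAt_slPotential hn hs hH3
  have hG : ContDiffAt ℂ 3 (stdForm n hn H) (consZero (mobiusArg n hn a b c d s)) :=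
    contDiffAt_stdForm hn (by rwa [tailArg_consZero])
  have hdiag := iteratedFDeriv_three_slPotential_diagonal hn hA hs hH hH3
  set w : ℂ := c * s (lastIdx n hn) + d
  set J := slJacobian n hn c w s
  set P := consZero (mobiusArg n hn a b c d s)
  set M : ContinuousMultilinearMap ℂ (fun _ : Fin 3 => Fin n → ℂ) ℂ :=
    iteratedFDeriv ℂ 3 (slPotential n hn a b c d H) s -
      w ^ 2 • (iteratedFDeriv ℂ 3 (stdForm n hn H) P).compContinuousLinearMap
        (fun _ => LinearMap.toContinuousLinearMap J)
  have hM : ∀ u v x, M ![u, v, x] = iteratedFDeriv ℂ 3 (slPotential n hn a b c d H) s ![u, v, x] -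
      w ^ 2 * iteratedFDeriv ℂ 3 (stdForm n hn H) P ![J u, J v, J x] := fun u v x => by
    have h : (fun i : Fin 3 => J (![u, v, x] i)) = ![J u, J v, J x] := by
      ext i; fin_cases i <;> rfl
    rw [← h]
    rfl
  refine sub_eq_zero.1 ((hM u v x).symm.trans (M.eq_zero_of_diagonal_three ?_ ?_ ?_ u v x))
  · intro u v x
    rw [hM, hM, iteratedFDeriv_three_swap_left hF, iteratedFDeriv_three_swap_left hG]
  · intro u v x
    rw [hM, hM, iteratedFDeriv_three_swap_right hF, iteratedFDeriv_three_swap_right hG]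
  · intro u
    have h : ∀ y : Fin n → ℂ, ![y, y, y] = fun _ => y := fun y => by
      ext i; fin_cases i <;> rfl
    rw [hM, h, h, hdiag, sub_self]

end Potential

section Associativity

variable {n : ℕ}

theorem IsLinearMap.eq_zero_of_single {f : (Fin n → ℂ) → ℂ} (hf : IsLinearMap ℂ f)
    (h : ∀ i, f (Pi.single i 1) = 0) (u : Fin n → ℂ) : f u = 0 := by
  have h0 := LinearMap.pi_apply_eq_sum_univ hf.mk' u
  refine h0.trans (Finset.sum_eq_zero fun i _ => ?_)
  have hi : (fun j => if i = j then (1 : ℂ) else 0) = Pi.single i 1 := by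
    ext j; simp [Pi.single_apply, eq_comm]
  rw [hi, IsLinearMap.mk'_apply, h, smul_zero]

/-- Associativity of the product defined by a trilinear form can be checked on basis vectors. -/
theorem MultilinearMap.assoc_of_single (T : MultilinearMap ℂ (fun _ : Fin 3 => Fin n → ℂ) ℂ)
    (hT : ∀ i j k l : Fin n,
      ∑ p : Fin n, T ![Pi.single i 1, Pi.single j 1, Pi.single p 1] *
        T ![Pi.single p.rev 1, Pi.single k 1, Pi.single l 1] =
      ∑ p : Fin n, T ![Pi.single i 1, Pi.single k 1, Pi.single p 1] *
        T ![Pi.single p.rev 1, Pi.single j 1, Pi.single l 1])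
    (u v x y : Fin n → ℂ) :
    ∑ p : Fin n, T ![u, v, Pi.single p 1] * T ![Pi.single p.rev 1, x, y] =
      ∑ p : Fin n, T ![u, x, Pi.single p 1] * T ![Pi.single p.rev 1, v, y] := by
  have upd₁ : ∀ a u v w : Fin n → ℂ, Function.update ![u, v, w] 0 a = ![a, v, w] := by
    intros; ext i; fin_cases i <;> rfl
  have upd₂ : ∀ a u v w : Fin n → ℂ, Function.update ![u, v, w] 1 a = ![u, a, w] := by
    intros; ext i; fin_cases i <;> rfl
  have upd₃ : ∀ a u v w : Fin n → ℂ, Function.update ![u, v, w] 2 a = ![u, v, a] := by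
    intros; ext i; fin_cases i <;> rfl
  have add₁ : ∀ a b v w, T ![a + b, v, w] = T ![a, v, w] + T ![b, v, w] := fun a b v w => by
    simpa only [upd₁] using T.map_update_add ![a, v, w] 0 a b
  have add₂ : ∀ a b v w, T ![v, a + b, w] = T ![v, a, w] + T ![v, b, w] := fun a b v w => by
    simpa only [upd₂] using T.map_update_add ![v, a, w] 1 a b
  have add₃ : ∀ a b v w, T ![v, w, a + b] = T ![v, w, a] + T ![v, w, b] := fun a b v w => by
    simpa only [upd₃] using T.map_update_add ![v, w, a] 2 a b
  have smul₁ : ∀ (z : ℂ) (a v w), T ![z • a, v, w] = z * T ![a, v, w] := fun z a v w => by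
    simpa only [upd₁, smul_eq_mul] using T.map_update_smul ![a, v, w] 0 z a
  have smul₂ : ∀ (z : ℂ) (a v w), T ![v, z • a, w] = z * T ![v, a, w] := fun z a v w => by
    simpa only [upd₂, smul_eq_mul] using T.map_update_smul ![v, a, w] 1 z a
  have smul₃ : ∀ (z : ℂ) (a v w), T ![v, w, z • a] = z * T ![v, w, a] := fun z a v w => by
    simpa only [upd₃, smul_eq_mul] using T.map_update_smul ![v, w, a] 2 z a
  have hsum : ∀ (z : ℂ) (f g : Fin n → ℂ), ∑ p, f p * (z * g p) = z * ∑ p, f p * g p :=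
    fun z f g => by rw [Finset.mul_sum]; exact Finset.sum_congr rfl fun p _ => by ring
  have hsum' : ∀ (z : ℂ) (f g : Fin n → ℂ), ∑ p, (z * f p) * g p = z * ∑ p, f p * g p :=
    fun z f g => by rw [Finset.mul_sum]; exact Finset.sum_congr rfl fun p _ => by ring
  rw [← sub_eq_zero]
  revert u
  refine IsLinearMap.eq_zero_of_single ⟨fun a b => ?_, fun z a => ?_⟩ fun i => ?_
  · simp only [add₁, add_mul, Finset.sum_add_distrib]; ring
  · simp only [smul₁, hsum', smul_eq_mul, mul_sub]
  revert v
  refine IsLinearMap.eq_zero_of_single ⟨fun a b => ?_, fun z a => ?_⟩ fun j => ?_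
  · simp only [add₂, add_mul, mul_add, Finset.sum_add_distrib]; ring
  · simp only [smul₂, hsum, hsum', smul_eq_mul, mul_sub]
  revert x
  refine IsLinearMap.eq_zero_of_single ⟨fun a b => ?_, fun z a => ?_⟩ fun k => ?_
  · simp only [add₂, add_mul, mul_add, Finset.sum_add_distrib]; ring
  · simp only [smul₂, hsum, hsum', smul_eq_mul, mul_sub]
  revert y
  refine IsLinearMap.eq_zero_of_single ⟨fun a b => ?_, fun z a => ?_⟩ fun l => ?_
  · simp only [add₃, mul_add, Finset.sum_add_distrib]; ring
  · simp only [smul₃, hsum, smul_eq_mul, mul_sub]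
  rw [hT, sub_self]

/-- The WDVV equation for a trilinear form is preserved by conformal changes of basis. -/
theorem MultilinearMap.assoc_comp_of_conformal
    (T : MultilinearMap ℂ (fun _ : Fin 3 => Fin n → ℂ) ℂ)
    (hT : ∀ i j k l : Fin n,
      ∑ p : Fin n, T ![Pi.single i 1, Pi.single j 1, Pi.single p 1] *
        T ![Pi.single p.rev 1, Pi.single k 1, Pi.single l 1] =
      ∑ p : Fin n, T ![Pi.single i 1, Pi.single k 1, Pi.single p 1] *
        T ![Pi.single p.rev 1, Pi.single j 1, Pi.single l 1])
    {μ : ℂ} (hμ : μ ≠ 0) (J : (Fin n → ℂ) →ₗ[ℂ] (Fin n → ℂ))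
    (hJ : ∀ u v, ∑ p, J u p * J v p.rev = μ * ∑ p, u p * v p.rev) (u v x y : Fin n → ℂ) :
    ∑ p : Fin n, T ![u, v, J (Pi.single p 1)] * T ![J (Pi.single p.rev 1), x, y] =
      ∑ p : Fin n, T ![u, x, J (Pi.single p 1)] * T ![J (Pi.single p.rev 1), v, y] := by
  have upd₁ : ∀ a v w : Fin n → ℂ, Function.update ![0, v, w] 0 a = ![a, v, w] := by
    intros; ext i; fin_cases i <;> rfl
  have upd₃ : ∀ a u v : Fin n → ℂ, Function.update ![u, v, 0] 2 a = ![u, v, a] := by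
    intros; ext i; fin_cases i <;> rfl
  have key := fun v x => sum_apply_single_mul_rev hμ J hJ (T.toLinearMap ![u, v, 0] 2)
    (T.toLinearMap ![0, x, y] 0)
  simp only [MultilinearMap.toLinearMap_apply, upd₁, upd₃] at key
  rw [key, key, T.assoc_of_single hT]

end Associativity

/-- If `F = stdForm H` satisfies WDVV on `ℂ × U`, then for any `A ∈ SL(2,ℂ)` the transformed
potential `F^A` satisfies WDVV wherever `ctⁿ+d ≠ 0` and the transformed argument lies in `U`. -/
theorem wdvv_sl2_action (n : ℕ) (hn : 2 ≤ n)
    (U : Set (Fin (n - 1) → ℂ)) (hU : IsOpen U)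
    (H : (Fin (n - 1) → ℂ) → ℂ) (hH : DifferentiableOn ℂ H U)
    (hWDVV : ∀ t : Fin n → ℂ, tailArg t ∈ U → WDVVAt (stdForm n hn H) t)
    (a b c d : ℂ) (hA : a * d - b * c = 1) :
    ∀ t : Fin n → ℂ, c * t (lastIdx n hn) + d ≠ 0 →
      mobiusArg n hn a b c d t ∈ U →
      WDVVAt (slPotential n hn a b c d H) t := by
  intro s hs hmem
  have hU' := hU.mem_nhds hmem
  have hH3 : ContDiffAt ℂ 3 H (mobiusArg n hn a b c d s) :=
    (hH.contDiffOn_of_finiteDimensional hU 3).contDiffAt hU'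
  have key := iteratedFDeriv_three_slPotential hn hA hs
    (by filter_upwards [hU'] with x hx using hH.differentiableAt (hU.mem_nhds hx)) hH3
  set w : ℂ := c * s (lastIdx n hn) + d
  have hP := hWDVV (consZero (mobiusArg n hn a b c d s)) (by rwa [tailArg_consZero])
  simp only [WDVVAt, sum_sum_antidiagonal_eq, D3] at hP
  have hassoc := MultilinearMap.assoc_comp_of_conformal
    (iteratedFDeriv ℂ 3 (stdForm n hn H) (consZero (mobiusArg n hn a b c d s))).toMultilinearMap
    hP (pow_ne_zero 2 (inv_ne_zero hs)) (slJacobian n hn c w s)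
    (sum_slJacobian_mul_rev hn c w s hs)
  simp only [WDVVAt, sum_sum_antidiagonal_eq]
  intro i j k l
  simp only [D3, key, mul_mul_mul_comm (w ^ 2), ← Finset.mul_sum]
  exact congrArg _ (hassoc _ _ _ _)
end

section
/- Define on ℂ⁵ × ℍ the genus-zero Gromov–Witten potential of the orbifold P¹_{2,2,2,2}: F₀(t₀,t₁,t₂,t₃,t₄,τ) := ½t₀²τ + ¼t₀(t₁²+t₂²+t₃²+t₄²) + H(t₁,t₂,t₃,t₄,τ), where H := (1/8)·t₁t₂t₃t₄·(X₃^∞(τ)−X₄^∞(τ)) − (1/192)·(t₁⁴+t₂⁴+t₃⁴+t₄⁴)·(4X₂^∞(τ)+X₃^∞(τ)+X₄^∞(τ)) − (1/32)·(∑_{1≤i<j≤4} tᵢ²tⱼ²)·(X₃^∞(τ)+X₄^∞(τ)). For A = ((a,b),(c,d)) ∈ SL(2,ℤ) define the transformed potential F₀^A(t₀,t₁,t₂,t₃,t₄,τ) := ½t₀²τ + ¼t₀(t₁²+t₂²+t₃²+t₄²) + (c/(8(cτ+d)))·(½(t₁²+t₂²+t₃²+t₄²))² + (cτ+d)²·H(t₁/(cτ+d),t₂/(cτ+d),t₃/(cτ+d),t₄/(cτ+d),(aτ+b)/(cτ+d))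 (this is the SL(2,ℂ)-action on Frobenius potentials adapted to the pairing with η(∂_{t₀},∂_τ)=1 and η(∂_{tᵢ},∂_{tᵢ})=½ for i=1,…,4). Then for every A ∈ Γ(2), i.e. every A ∈ SL(2,ℤ) with A ≡ I (mod 2), one has F₀^A = F₀ on ℂ⁵ × ℍ. -/
open Complex

/-- The theta-constant `ϑ₂(τ) = ∑_{n∈ℤ} q^{(n-1/2)²}`, `q = exp(πiτ)`. -/
noncomputable def theta2 (τ : ℂ) : ℂ :=
  ∑' n : ℤ, Complex.exp (Real.pi * Complex.I * τ * ((n : ℂ) - 1 / 2) ^ 2)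

/-- The theta-constant `ϑ₃(τ) = ∑_{n∈ℤ} q^{n²}`, `q = exp(πiτ)`. -/
noncomputable def theta3 (τ : ℂ) : ℂ :=
  ∑' n : ℤ, Complex.exp (Real.pi * Complex.I * τ * (n : ℂ) ^ 2)

/-- The theta-constant `ϑ₄(τ) = ∑_{n∈ℤ} (-1)ⁿ q^{n²}`, `q = exp(πiτ)`. -/
noncomputable def theta4 (τ : ℂ) : ℂ :=
  ∑' n : ℤ, (-1 : ℂ) ^ n * Complex.exp (Real.pi * Complex.I * τ * (n : ℂ) ^ 2)

/-- `X₂^∞ = 2 ϑ₂'/ϑ₂`. -/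
noncomputable def X2 (τ : ℂ) : ℂ := 2 * deriv theta2 τ / theta2 τ

/-- `X₃^∞ = 2 ϑ₃'/ϑ₃`. -/
noncomputable def X3 (τ : ℂ) : ℂ := 2 * deriv theta3 τ / theta3 τ

/-- `X₄^∞ = 2 ϑ₄'/ϑ₄`. -/
noncomputable def X4 (τ : ℂ) : ℂ := 2 * deriv theta4 τ / theta4 τ


/-- The non-cubic part `H` of the genus-zero Gromov–Witten potential of `ℙ¹_{2,2,2,2}`. -/
noncomputable def Hpot (t1 t2 t3 t4 τ : ℂ) : ℂ :=
  1 / 8 * (t1 * t2 * t3 * t4) * (X3 τ - X4 τ)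
  - 1 / 192 * (t1 ^ 4 + t2 ^ 4 + t3 ^ 4 + t4 ^ 4) * (4 * X2 τ + X3 τ + X4 τ)
  - 1 / 32 * (t1 ^ 2 * t2 ^ 2 + t1 ^ 2 * t3 ^ 2 + t1 ^ 2 * t4 ^ 2
      + t2 ^ 2 * t3 ^ 2 + t2 ^ 2 * t4 ^ 2 + t3 ^ 2 * t4 ^ 2) * (X3 τ + X4 τ)

/-- The genus-zero Gromov–Witten potential of the orbifold `ℙ¹_{2,2,2,2}`. -/
noncomputable def F0 (t0 t1 t2 t3 t4 τ : ℂ) : ℂ :=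
  1 / 2 * t0 ^ 2 * τ + 1 / 4 * t0 * (t1 ^ 2 + t2 ^ 2 + t3 ^ 2 + t4 ^ 2) + Hpot t1 t2 t3 t4 τ

/-- The `SL(2,ℂ)`-transformed potential `F₀^A` (for the pairing with `η(∂_{t₀},∂_τ) = 1`,
`η(∂_{tᵢ},∂_{tᵢ}) = ½`). -/
noncomputable def F0A (a b c d : ℂ) (t0 t1 t2 t3 t4 τ : ℂ) : ℂ :=
  1 / 2 * t0 ^ 2 * τ + 1 / 4 * t0 * (t1 ^ 2 + t2 ^ 2 + t3 ^ 2 + t4 ^ 2)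
  + c / (8 * (c * τ + d)) * (1 / 2 * (t1 ^ 2 + t2 ^ 2 + t3 ^ 2 + t4 ^ 2)) ^ 2
  + (c * τ + d) ^ 2 * Hpot (t1 / (c * τ + d)) (t2 / (c * τ + d)) (t3 / (c * τ + d))
      (t4 / (c * τ + d)) ((a * τ + b) / (c * τ + d))

section ThetaConstants

lemma theta3_eq_jacobiTheta₂ (τ : ℂ) : theta3 τ = jacobiTheta₂ 0 τ := by
  refine tsum_congr fun n => ?_
  rw [jacobiTheta₂_term]
  ring_nf

lemma exp_pi_mul_I_mul_int (n : ℤ) : Complex.exp (Real.pi * I * n) = (-1) ^ n := by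
  rw [mul_comm, exp_int_mul, exp_pi_mul_I]

lemma theta4_eq_jacobiTheta₂ (τ : ℂ) : theta4 τ = jacobiTheta₂ (1 / 2) τ := by
  refine tsum_congr fun n => ?_
  rw [jacobiTheta₂_term, ← exp_pi_mul_I_mul_int, ← Complex.exp_add]
  ring_nf

lemma theta2_eq_jacobiTheta₂ (τ : ℂ) :
    theta2 τ = Complex.exp (Real.pi * I * τ / 4) * jacobiTheta₂ (-τ / 2) τ := by
  rw [jacobiTheta₂, ← tsum_mul_left]
  refine tsum_congr fun n => ?_
  rw [jacobiTheta₂_term, ← Complex.exp_add]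
  ring_nf

lemma differentiableAt_theta3 {τ : ℂ} (hτ : 0 < τ.im) : DifferentiableAt ℂ theta3 τ := by
  rw [funext theta3_eq_jacobiTheta₂]
  exact differentiableAt_jacobiTheta₂_snd 0 hτ

lemma differentiableAt_theta4 {τ : ℂ} (hτ : 0 < τ.im) : DifferentiableAt ℂ theta4 τ := by
  rw [funext theta4_eq_jacobiTheta₂]
  exact differentiableAt_jacobiTheta₂_snd _ hτ

lemma differentiableAt_theta2 {τ : ℂ} (hτ : 0 < τ.im) : DifferentiableAt ℂ theta2 τ := by
  rw [funext theta2_eq_jacobiTheta₂]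
  refine DifferentiableAt.mul (by fun_prop) ?_
  exact (hasFDerivAt_jacobiTheta₂ (-τ / 2) hτ).differentiableAt.comp τ
    (f := fun w : ℂ => (-w / 2, w)) (by fun_prop)

lemma theta3_add_one (τ : ℂ) : theta3 (τ + 1) = theta4 τ := by
  refine tsum_congr fun n => ?_
  rw [← exp_pi_mul_I_mul_int, ← Complex.exp_add, Complex.exp_eq_exp_iff_exists_int]
  obtain ⟨m, hm⟩ := Int.even_mul_succ_self (n - 1)
  refine ⟨m, ?_⟩
  have h : ((n : ℂ) - 1) * n = m + m := by
    have := congrArg (Int.cast (R := ℂ)) hm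
    push_cast at this
    linear_combination this
  linear_combination Real.pi * I * h

lemma theta4_add_one (τ : ℂ) : theta4 (τ + 1) = theta3 τ := by
  rw [← theta3_add_one, add_assoc, one_add_one_eq_two, theta3_eq_jacobiTheta₂,
    jacobiTheta₂_add_right, theta3_eq_jacobiTheta₂]

lemma theta2_add_one (τ : ℂ) : theta2 (τ + 1) = Complex.exp (Real.pi * I / 4) * theta2 τ := by
  rw [theta2, theta2, ← tsum_mul_left]
  refine tsum_congr fun n => ?_
  rw [← Complex.exp_add, Complex.exp_eq_exp_iff_exists_int]
  obtain ⟨m, hm⟩ := Int.even_mul_succ_self (n - 1)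
  refine ⟨m, ?_⟩
  have h : ((n : ℂ) - 1) * n = m + m := by
    have := congrArg (Int.cast (R := ℂ)) hm
    push_cast at this
    linear_combination this
  linear_combination Real.pi * I * h

lemma theta3_eq_mul_theta3_neg_inv (τ : ℂ) :
    theta3 τ = 1 / (-I * τ) ^ (1 / 2 : ℂ) * theta3 (-1 / τ) := by
  rw [theta3_eq_jacobiTheta₂, jacobiTheta₂_functional_equation, theta3_eq_jacobiTheta₂]
  simp

lemma theta4_eq_mul_theta2_neg_inv (τ : ℂ) :
    theta4 τ = 1 / (-I * τ) ^ (1 / 2 : ℂ) * theta2 (-1 / τ) := by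
  rw [theta4_eq_jacobiTheta₂, jacobiTheta₂_functional_equation, theta2_eq_jacobiTheta₂]
  ring_nf

lemma theta2_eq_mul_theta4_neg_inv {τ : ℂ} (hτ : 0 < τ.im) :
    theta2 τ = 1 / (-I * τ) ^ (1 / 2 : ℂ) * theta4 (-1 / τ) := by
  have h0 : τ ≠ 0 := fun h => by simp [h] at hτ
  rw [theta2_eq_jacobiTheta₂, jacobiTheta₂_functional_equation, theta4_eq_jacobiTheta₂,
    show -τ / 2 / τ = -(1 / 2) by field_simp, jacobiTheta₂_neg_left]
  have : Complex.exp (Real.pi * I * τ / 4) * Complex.exp (-Real.pi * I * (-τ / 2) ^ 2 / τ) = 1 := by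
    rw [← Complex.exp_add, ← Complex.exp_zero]
    congr 1
    field_simp
    ring
  linear_combination (1 / (-I * τ) ^ (1 / 2 : ℂ) * jacobiTheta₂ (1 / 2) (-1 / τ)) * this

end ThetaConstants

section Nonvanishing

lemma HasSum.ne_zero_of_norm_le_pow {f : ℕ → ℂ} {s : ℂ} (hf : HasSum f s) {r : ℝ}
    (hr : r < 1 / 2) (h0 : f 0 = 1) (h : ∀ n, ‖f (n + 1)‖ ≤ r ^ (n + 1)) : s ≠ 0 := by
  have hr0 : 0 ≤ r := by simpa using (norm_nonneg _).trans (h 0)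
  have hg : HasSum (fun n : ℕ => r ^ (n + 1)) (r / (1 - r)) := by
    simpa only [pow_succ', div_eq_mul_inv] using
      (hasSum_geometric_of_lt_one hr0 (by linarith)).mul_left r
  have h1 := ((hasSum_nat_add_iff' 1).2 hf).norm_le_of_bounded hg h
  rintro rfl
  rw [Finset.sum_range_one, h0, zero_sub, norm_neg, norm_one, le_div_iff₀ (by linarith)] at h1
  linarith

lemma exp_neg_pi_mul_lt_third {y : ℝ} (hy : 3 ≤ 4 * y ^ 2) (hy0 : 0 < y) :
    Real.exp (-Real.pi * y) < 1 / 3 := by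
  have h1 : 2 < Real.pi * y := by nlinarith [Real.pi_gt_three]
  have h2 := Real.add_one_lt_exp (x := Real.pi * y) (by linarith)
  rw [neg_mul, Real.exp_neg, inv_lt_comm₀ (Real.exp_pos _) (by norm_num)]
  norm_num
  linarith

lemma theta3_ne_zero_of_three_le {τ : ℂ} (hτ : 0 < τ.im) (h : 3 ≤ 4 * τ.im ^ 2) :
    theta3 τ ≠ 0 := by
  have h1 := norm_jacobiTheta_sub_one_le hτ
  have h2 := exp_neg_pi_mul_lt_third h hτ
  rw [jacobiTheta_eq_jacobiTheta₂, ← theta3_eq_jacobiTheta₂] at h1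
  intro h3
  rw [h3, zero_sub, norm_neg, norm_one, div_mul_eq_mul_div, le_div_iff₀ (by linarith)] at h1
  linarith

lemma summable_theta2 {τ : ℂ} (hτ : 0 < τ.im) :
    Summable fun n : ℤ => Complex.exp (Real.pi * I * τ * ((n : ℂ) - 1 / 2) ^ 2) := by
  refine (((summable_jacobiTheta₂_term_iff (-τ / 2) τ).2 hτ).mul_left
    (Complex.exp (Real.pi * I * τ / 4))).congr fun n => ?_
  rw [jacobiTheta₂_term, ← Complex.exp_add]
  ring_nf

lemma theta2_ne_zero_of_three_le {τ : ℂ} (hτ : 0 < τ.im) (h : 3 ≤ 4 * τ.im ^ 2) :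
    theta2 τ ≠ 0 := by
  have h1 : HasSum (fun n : ℤ => Complex.exp (Real.pi * I * τ * (((n + 1 : ℤ) : ℂ) - 1 / 2) ^ 2))
      (theta2 τ) :=
    (Equiv.addRight (1 : ℤ)).hasSum_iff.2 (summable_theta2 hτ).hasSum
  have h2 := (h1.nat_add_neg_add_one).mul_left (Complex.exp (-(Real.pi * I * τ / 4)) / 2)
  have h3 : HasSum (fun n : ℕ => Complex.exp (Real.pi * I * τ * (n * (n + 1))))
      (Complex.exp (-(Real.pi * I * τ / 4)) / 2 * theta2 τ) := by
    refine h2.congr_fun fun n => ?_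
    rw [div_mul_eq_mul_div, mul_add (Complex.exp _), ← Complex.exp_add, ← Complex.exp_add]
    push_cast
    ring_nf
  refine right_ne_zero_of_mul (h3.ne_zero_of_norm_le_pow (r := Real.exp (-Real.pi * τ.im))
    (by linarith [exp_neg_pi_mul_lt_third h hτ]) (by simp) fun n => ?_)
  rw [Complex.norm_exp, ← Real.exp_nat_mul, Real.exp_le_exp]
  have h4 : (Real.pi * I * τ * (((n + 1 : ℕ) : ℂ) * (((n + 1 : ℕ) : ℂ) + 1))).re
      = -(Real.pi * τ.im) * ((n + 1) * (n + 2)) := by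
    rw [show Real.pi * I * τ * (((n + 1 : ℕ) : ℂ) * (((n + 1 : ℕ) : ℂ) + 1))
      = ((Real.pi * ((n + 1) * (n + 2)) : ℝ) : ℂ) * (I * τ) by push_cast; ring,
      Complex.re_ofReal_mul]
    simp only [Complex.I_mul_re]
    ring
  rw [h4]
  push_cast
  have h5 : 0 < Real.pi * τ.im * (n + 1) := by positivity
  nlinarith [mul_nonneg h5.le (Nat.cast_nonneg (α := ℝ) n)]

end Nonvanishing

section NonvanishingOnUpperHalfPlane

open scoped MatrixGroups
open UpperHalfPlane hiding I
open ModularGroup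

lemma coe_S_smul (τ : ℍ) : ((S • τ : ℍ) : ℂ) = -1 / τ := by
  rw [modular_S_smul, coe_mk, neg_div, one_div, inv_neg]

lemma coe_T_smul (τ : ℍ) : ((T • τ : ℍ) : ℂ) = τ + 1 := by
  rw [modular_T_smul, coe_vadd, ofReal_one, add_comm]

lemma neg_I_mul_cpow_ne_zero {τ : ℂ} (hτ : 0 < τ.im) : (-I * τ) ^ (1 / 2 : ℂ) ≠ 0 := by
  have h0 : τ ≠ 0 := fun h => by simp [h] at hτ
  simp [Complex.cpow_eq_zero_iff, h0]

lemma theta_mul_ne_zero_smul_iff (g : SL(2, ℤ)) (τ : ℍ) :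
    theta2 ↑(g • τ) * theta3 ↑(g • τ) * theta4 ↑(g • τ) ≠ 0 ↔
      theta2 τ * theta3 τ * theta4 τ ≠ 0 := by
  have hg : g ∈ Subgroup.closure {S, T} := by simp [SpecialLinearGroup.SL2Z_generators]
  induction hg using Subgroup.closure_induction generalizing τ with
  | one => rw [one_smul]
  | mem g hg =>
    rcases hg with rfl | rfl
    · rw [coe_S_smul, theta2_eq_mul_theta4_neg_inv τ.2, theta3_eq_mul_theta3_neg_inv τ,
        theta4_eq_mul_theta2_neg_inv τ]
      have := neg_I_mul_cpow_ne_zero τ.2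
      simp only [ne_eq, mul_eq_zero, div_eq_zero_iff, one_ne_zero, this, false_or]
      tauto
    · rw [coe_T_smul, theta2_add_one, theta3_add_one, theta4_add_one]
      simp only [ne_eq, mul_eq_zero, Complex.exp_ne_zero, false_or]
      tauto
  | mul g h _ _ ihg ihh =>
    rw [mul_smul]
    exact (ihg _).trans (ihh _)
  | inv g _ ih => simpa only [smul_inv_smul] using (ih (g⁻¹ • τ)).symm

lemma theta_mul_ne_zero (τ : ℍ) : theta2 τ * theta3 τ * theta4 τ ≠ 0 := by
  obtain ⟨g, hg⟩ := exists_smul_mem_fd τ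
  have h := three_le_four_mul_im_sq_of_mem_fd hg
  rw [← theta_mul_ne_zero_smul_iff g]
  refine mul_ne_zero (mul_ne_zero (theta2_ne_zero_of_three_le (g • τ).2 h)
    (theta3_ne_zero_of_three_le (g • τ).2 h)) ?_
  rw [← theta3_add_one]
  exact theta3_ne_zero_of_three_le (by simpa using (g • τ).2) (by simpa using h)

end NonvanishingOnUpperHalfPlane

section LogDeriv

lemma two_mul_logDeriv_of_neg_inv {f g : ℂ → ℂ}
    (hfg : ∀ {w : ℂ}, 0 < w.im → f w = 1 / (-I * w) ^ (1 / 2 : ℂ) * g (-1 / w))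
    {τ : ℂ} (hτ : 0 < τ.im) (hg : DifferentiableAt ℂ g (-1 / τ)) (hf : f τ ≠ 0) :
    2 * logDeriv f τ = -1 / τ + 2 * logDeriv g (-1 / τ) / τ ^ 2 := by
  have h0 : τ ≠ 0 := fun h => by simp [h] at hτ
  have hslit : -I * τ ∈ Complex.slitPlane := Or.inl (by simpa using hτ)
  have hg0 : g (-1 / τ) ≠ 0 := right_ne_zero_of_mul (hfg hτ ▸ hf)
  have hev : f =ᶠ[nhds τ] fun w => (-I * w) ^ (-(1 / 2) : ℂ) * (g ∘ fun z => -1 / z) w := by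
    filter_upwards [(isOpen_lt continuous_const Complex.continuous_im).mem_nhds hτ] with w hw
    rw [hfg hw, Complex.cpow_neg, one_div, Function.comp_apply]
  have hd : HasDerivAt (fun w : ℂ => -1 / w) (1 / τ ^ 2) τ := by
    simpa [div_eq_mul_inv] using ((hasDerivAt_id τ).fun_inv h0).const_mul (-1)
  have hp : HasDerivAt (fun w : ℂ => (-I * w) ^ (-(1 / 2) : ℂ))
      (-(1 / 2) * (-I * τ) ^ (-(1 / 2) - 1 : ℂ) * (-I)) τ := by
    simpa using ((hasDerivAt_id τ).const_mul (-I)).cpow_const (c := -(1 / 2)) (by simpa using hslit)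
  have hI : -I * τ ≠ 0 := Complex.slitPlane_ne_zero hslit
  rw [(logDeriv_congr_nhds hev).self_of_nhds, logDeriv_mul τ
    (by simp [Complex.cpow_eq_zero_iff, h0]) hg0 hp.differentiableAt
    (hg.comp τ hd.differentiableAt), logDeriv_comp hg hd.differentiableAt, hd.deriv,
    logDeriv_apply, hp.deriv, Complex.cpow_sub _ _ hI, Complex.cpow_one]
  have := (Complex.cpow_ne_zero_iff_of_exponent_ne_zero (x := -I * τ) (y := -(1 / 2))
    (by norm_num)).2 hI
  have := I_ne_zero
  field_simp

end LogDeriv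

section ModularTransformation

open scoped MatrixGroups ModularForm
open UpperHalfPlane hiding I
open ModularGroup EisensteinSeries Matrix

/-- The theta-constant logarithmic derivatives, scaled by `2πi` and indexed by the nonzero row
vectors of `𝔽₂²`, on which `SL(2, ℤ)` acts from the right; the value at `0` is irrelevant. -/
noncomputable def thetaLogDeriv (v : Fin 2 → ZMod 2) (τ : ℍ) : ℂ :=
  2 * Real.pi * I * (if v 0 = 0 then X2 τ else if v 1 = 0 then X4 τ else X3 τ)

/-- Right action of `SL(2, ℤ)` on row vectors over `𝔽₂`. -/
def rowAction (v : Fin 2 → ZMod 2) (γ : SL(2, ℤ)) : Fin 2 → ZMod 2 :=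
  v ᵥ* γ.1.map (Int.cast : ℤ → ZMod 2)

lemma rowAction_one (v : Fin 2 → ZMod 2) : rowAction v 1 = v := by
  simp [rowAction]

lemma rowAction_mul (v : Fin 2 → ZMod 2) (γ δ : SL(2, ℤ)) :
    rowAction v (γ * δ) = rowAction (rowAction v γ) δ := by
  rw [rowAction, rowAction, rowAction, vecMul_vecMul]
  congr 1
  exact Matrix.map_mul (f := Int.castRingHom (ZMod 2))

lemma rowAction_ne_zero {v : Fin 2 → ZMod 2} (hv : v ≠ 0) (γ : SL(2, ℤ)) :
    rowAction v γ ≠ 0 := by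
  intro h
  apply hv
  rw [← rowAction_one v, ← mul_inv_cancel γ, rowAction_mul, h, rowAction, zero_vecMul]

lemma X_eq_two_mul_logDeriv (τ : ℂ) : X2 τ = 2 * logDeriv theta2 τ ∧
    X3 τ = 2 * logDeriv theta3 τ ∧ X4 τ = 2 * logDeriv theta4 τ := by
  simp only [X2, X3, X4, logDeriv_apply, mul_div_assoc, and_self]

lemma logDeriv_add_one_of_eq {f g : ℂ → ℂ} {c : ℂ} (hc : c ≠ 0)
    (hfg : ∀ w, f (w + 1) = c * g w) (τ : ℂ) : logDeriv f (τ + 1) = logDeriv g τ := by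
  rw [← logDeriv_const_mul τ c hc, ← funext hfg, logDeriv_apply, logDeriv_apply,
    deriv_comp_add_const]

lemma X_add_one (τ : ℂ) :
    X2 (τ + 1) = X2 τ ∧ X3 (τ + 1) = X4 τ ∧ X4 (τ + 1) = X3 τ := by
  simp only [X_eq_two_mul_logDeriv]
  rw [logDeriv_add_one_of_eq (Complex.exp_ne_zero _) theta2_add_one,
    logDeriv_add_one_of_eq one_ne_zero (by simpa using theta3_add_one),
    logDeriv_add_one_of_eq one_ne_zero (by simpa using theta4_add_one)]
  simp

lemma X_neg_inv (τ : ℍ) :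
    X2 τ = -1 / τ + X4 (-1 / τ) / τ ^ 2 ∧ X3 τ = -1 / τ + X3 (-1 / τ) / τ ^ 2 ∧
      X4 τ = -1 / τ + X2 (-1 / τ) / τ ^ 2 := by
  have h := theta_mul_ne_zero τ
  simp only [ne_eq, mul_eq_zero, not_or] at h
  have him : 0 < (-1 / (τ : ℂ)).im := coe_S_smul τ ▸ (S • τ).2
  simp only [X_eq_two_mul_logDeriv]
  exact ⟨two_mul_logDeriv_of_neg_inv theta2_eq_mul_theta4_neg_inv τ.2
      (differentiableAt_theta4 him) h.1.1,
    two_mul_logDeriv_of_neg_inv (fun _ => theta3_eq_mul_theta3_neg_inv _) τ.2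
      (differentiableAt_theta3 him) h.1.2,
    two_mul_logDeriv_of_neg_inv (fun _ => theta4_eq_mul_theta2_neg_inv _) τ.2
      (differentiableAt_theta2 him) h.2⟩

lemma thetaLogDeriv_slash_S {v : Fin 2 → ZMod 2} (hv : v ≠ 0) :
    thetaLogDeriv v ∣[(2 : ℤ)] S = thetaLogDeriv (rowAction v S) + D2 S := by
  ext τ
  obtain ⟨h2, h3, h4⟩ := X_neg_inv τ
  have h0 : (τ : ℂ) ≠ 0 := ne_zero τ
  rw [ModularForm.SL_slash_apply, Pi.add_apply, D2_S, denom_S, thetaLogDeriv, thetaLogDeriv,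
    coe_S_smul]
  have hr : rowAction v S = ![v 1, v 0] := by
    ext i; fin_cases i <;> simp [rowAction, S, vecMul, dotProduct]
  rw [hr]
  simp only [cons_val_zero, cons_val_one, h2, h3, h4]
  split_ifs with a b b <;> first
    | (exfalso; apply hv; ext i; fin_cases i <;> assumption)
    | (field_simp; ring)

lemma thetaLogDeriv_slash_T (v : Fin 2 → ZMod 2) :
    thetaLogDeriv v ∣[(2 : ℤ)] T = thetaLogDeriv (rowAction v T) + D2 T := by
  ext τ
  obtain ⟨h2, h3, h4⟩ := X_add_one τ
  have hd : denom (T : SL(2, ℤ)) τ = 1 := by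
    rw [ModularGroup.denom_apply]
    simp [T]
  rw [ModularForm.SL_slash_apply, D2_T, add_zero, hd, _root_.one_zpow, mul_one, thetaLogDeriv,
    thetaLogDeriv, coe_T_smul, h2, h3, h4]
  have hr : rowAction v T = ![v 0, v 0 + v 1] := by
    ext i; fin_cases i <;> simp [rowAction, T, vecMul, dotProduct]
  rw [hr]
  simp only [cons_val_zero, cons_val_one]
  have hxy : ∀ x y : ZMod 2, x = 0 ∨ (x + y = 0 ↔ y ≠ 0) := by decide
  rcases hxy (v 0) (v 1) with h | h
  · simp only [h, if_true]
  · simp only [h, ne_eq, ite_not]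

lemma thetaLogDeriv_slash {v : Fin 2 → ZMod 2} (hv : v ≠ 0) (γ : SL(2, ℤ)) :
    thetaLogDeriv v ∣[(2 : ℤ)] γ = thetaLogDeriv (rowAction v γ) + D2 γ := by
  have hγ : γ ∈ Subgroup.closure {S, T} := by simp [SpecialLinearGroup.SL2Z_generators]
  induction hγ using Subgroup.closure_induction generalizing v with
  | one => rw [SlashAction.slash_one, rowAction_one, D2_one, add_zero]
  | mem g hg =>
    rcases hg with rfl | rfl
    · exact thetaLogDeriv_slash_S hv
    · exact thetaLogDeriv_slash_T v
  | mul g h _ _ ihg ihh =>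
    rw [SlashAction.slash_mul, ihg hv, SlashAction.add_slash, ihh (rowAction_ne_zero hv g),
      rowAction_mul, D2_mul, add_assoc, add_comm (D2 h)]
  | inv g _ ih =>
    have h := congrArg (· ∣[(2 : ℤ)] g⁻¹) (ih (rowAction_ne_zero hv g⁻¹))
    simp only [← SlashAction.slash_mul, SlashAction.add_slash, mul_inv_cancel,
      SlashAction.slash_one, ← rowAction_mul, inv_mul_cancel, rowAction_one, D2_inv] at h
    rw [h]
    abel

/-- `X₂`, `X₃`, `X₄` are quasimodular of weight `2` for `Γ(2)`. -/
lemma X_Gamma2_smul {a b c d : ℤ} (hdet : a * d - b * c = 1)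
    (ha : a % 2 = 1) (hb : b % 2 = 0) (hc : c % 2 = 0) (hd : d % 2 = 1) {τ : ℂ} (hτ : 0 < τ.im) :
    c * τ + d ≠ 0 ∧ ∀ X ∈ ({X2, X3, X4} : Set (ℂ → ℂ)),
      X ((a * τ + b) / (c * τ + d)) = (c * τ + d) ^ 2 * X τ + c * (c * τ + d) := by
  let γ : SL(2, ℤ) := ⟨!![a, b; c, d], by rw [det_fin_two_of, hdet]⟩
  let z : ℍ := ⟨τ, hτ⟩
  have hden : denom γ z = c * τ + d := by
    rw [ModularGroup.denom_apply]
    simp [γ, z]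
  have h0 : c * τ + d ≠ 0 := hden ▸ denom_ne_zero γ z
  refine ⟨h0, ?_⟩
  have hsmul : ((γ • z : ℍ) : ℂ) = (a * τ + b) / (c * τ + d) := by
    rw [coe_specialLinearGroup_apply]
    simp [γ, z]
  have hrow (v : Fin 2 → ZMod 2) : rowAction v γ = v := by
    have ha' : (a : ZMod 2) = 1 := by exact_mod_cast (ZMod.intCast_eq_intCast_iff' a 1 2).2 ha
    have hb' : (b : ZMod 2) = 0 := by exact_mod_cast (ZMod.intCast_eq_intCast_iff' b 0 2).2 hb
    have hc' : (c : ZMod 2) = 0 := by exact_mod_cast (ZMod.intCast_eq_intCast_iff' c 0 2).2 hc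
    have hd' : (d : ZMod 2) = 1 := by exact_mod_cast (ZMod.intCast_eq_intCast_iff' d 1 2).2 hd
    ext i
    fin_cases i <;> simp [rowAction, γ, vecMul, dotProduct, ha', hb', hc', hd']
  have key (v : Fin 2 → ZMod 2) (hv : v ≠ 0) := congrFun (thetaLogDeriv_slash hv γ) z
  simp only [ModularForm.SL_slash_apply, Pi.add_apply, D2, hden, thetaLogDeriv, hsmul, hrow] at key
  have hpi : (Real.pi : ℂ) ≠ 0 := ofReal_ne_zero.2 Real.pi_ne_zero
  have conclude {x y : ℂ} (h : 2 * Real.pi * I * x * (c * τ + d) ^ (-2 : ℤ) =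
      2 * Real.pi * I * y + 2 * Real.pi * I * c / (c * τ + d)) :
      x = (c * τ + d) ^ 2 * y + c * (c * τ + d) := by
    have := I_ne_zero
    rw [_root_.zpow_neg, zpow_two] at h
    field_simp at h
    linear_combination h
  rintro X (rfl | rfl | rfl)
  · exact conclude (by simpa [γ, z] using key ![0, 1] (by simp))
  · exact conclude (by simpa [γ, z] using key ![1, 1] (by simp))
  · exact conclude (by simpa [γ, z] using key ![1, 0] (by simp))

end ModularTransformation

/-- The genus-zero potential of `ℙ¹_{2,2,2,2}` is invariant under the `SL(2,ℂ)`-action of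
the principal congruence subgroup `Γ(2)`: for `A ∈ SL(2,ℤ)` with `A ≡ I (mod 2)`,
`F₀^A = F₀` on `ℂ⁵ × ℍ`. -/
theorem F0_Gamma2_invariant
    (a b c d : ℤ) (hdet : a * d - b * c = 1)
    (ha : a % 2 = 1) (hb : b % 2 = 0) (hc : c % 2 = 0) (hd : d % 2 = 1)
    (t0 t1 t2 t3 t4 : ℂ) (τ : ℂ) (hτ : 0 < τ.im) :
    F0A (a : ℂ) (b : ℂ) (c : ℂ) (d : ℂ) t0 t1 t2 t3 t4 τ = F0 t0 t1 t2 t3 t4 τ := by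
  obtain ⟨h0, hX⟩ := X_Gamma2_smul hdet ha hb hc hd hτ
  rw [F0A, F0, Hpot, Hpot, hX X2 (by simp), hX X3 (by simp), hX X4 (by simp)]
  generalize (c : ℂ) * τ + d = j at h0 ⊢
  field_simp
  ring
end

section
/- For all integers n ≥ p ≥ 1, the number of primitive cyclic compositions of n into p parts is Cy_prim(n,p) = (1/n)·∑_{a | gcd(n,p)} μ(a)·C(n/a, p/a), where μ is the Möbius function, C(·,·) is the binomial coefficient, and the sum runs over the positive divisors a of gcd(n,p). -/
/-- `f : Fin p → ℕ` is a composition of `n` into `p` (positive) parts. -/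
def IsComp (n p : ℕ) (f : Fin p → ℕ) : Prop :=
  (∀ i, 1 ≤ f i) ∧ ∑ i, f i = n

/-- The orbit of `f : Fin p → ℕ` under the rotation action of `ℤ/pℤ`. -/
def orbitOf {p : ℕ} (f : Fin p → ℕ) : Set (Fin p → ℕ) :=
  {g | ∃ k : Fin p, g = fun i => f (i + k)}

/-- The set of cyclic compositions of `n` into `p` parts, i.e. of rotation-orbits of
compositions of `n` into `p` parts. -/
def cycSet (n p : ℕ) : Set (Set (Fin p → ℕ)) :=
  {S | ∃ f : Fin p → ℕ, IsComp n p f ∧ S = orbitOf f}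

/-- `Cy n p`: the number of cyclic compositions of `n` into `p` parts. -/
noncomputable def Cy (n p : ℕ) : ℕ := (cycSet n p).ncard

/-- `CyPrim n p`: the number of primitive cyclic compositions of `n` into `p` parts,
i.e. of rotation-orbits with exactly `p` elements. -/
noncomputable def CyPrim (n p : ℕ) : ℕ :=
  {S | ∃ f : Fin p → ℕ, IsComp n p f ∧ S = orbitOf f ∧ S.ncard = p}.ncard

/-- The order of the (common) rotation-stabilizer of the elements of `S`. -/
noncomputable def stabOrd {p : ℕ} (S : Set (Fin p → ℕ)) : ℕ :=
  {k : Fin p | ∀ f ∈ S, (fun i => f (i + k)) = f}.ncard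

open Function

/-- The compositions of `n` into `p` positive parts, as a finset. -/
def compositionFinset (n p : ℕ) : Finset (Fin p → ℕ) :=
  {f ∈ Finset.finAntidiagonal p n | ∀ i, 1 ≤ f i}

theorem mem_compositionFinset {n p : ℕ} {f : Fin p → ℕ} :
    f ∈ compositionFinset n p ↔ IsComp n p f := by
  simp [compositionFinset, IsComp, and_comm]

theorem card_compositionFinset {n p : ℕ} (hpn : p ≤ n) :
    (compositionFinset n p).card = (p + (n - p) - 1).choose (n - p) := by
  have e : {P : Fin p → ℕ // ∑ i, P i = n - p} ≃ compositionFinset n p :=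
    { toFun := fun P => ⟨fun i => P.1 i + 1, by
        rw [mem_compositionFinset]
        refine ⟨fun i => Nat.le_add_left _ _, ?_⟩
        rw [Finset.sum_add_distrib, P.2]
        simp [hpn]⟩
      invFun := fun f => ⟨fun i => f.1 i - 1, by
        obtain ⟨h1, h2⟩ := mem_compositionFinset.1 f.2
        rw [Finset.sum_tsub_distrib _ fun i _ => h1 i, h2]
        simp⟩
      left_inv := fun P => by ext; simp
      right_inv := fun f => by
        ext i
        exact Nat.sub_add_cancel ((mem_compositionFinset.1 f.2).1 i) }
  rw [← Fintype.card_coe, ← Fintype.card_congr ((Sym.equivNatSumOfFintype (Fin p) (n - p)).trans e),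
    Sym.card_sym_eq_choose, Fintype.card_fin]

theorem mul_card_compositionFinset {n p : ℕ} (hp : 1 ≤ p) (hpn : p ≤ n) :
    n * (compositionFinset n p).card = p * n.choose p := by
  obtain ⟨q, rfl⟩ := Nat.exists_eq_add_of_le' hp
  obtain ⟨m, rfl⟩ := Nat.exists_eq_add_of_le' (hp.trans hpn)
  have hqm : q ≤ m := by omega
  rw [card_compositionFinset hpn, show q + 1 + (m + 1 - (q + 1)) - 1 = m by omega,
    show m + 1 - (q + 1) = m - q by omega, Nat.choose_symm hqm, mul_comm (q + 1),
    Nat.add_one_mul_choose_eq]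

/-- Rotation of a tuple by one step. -/
def rotateOne {p : ℕ} [NeZero p] (f : Fin p → ℕ) : Fin p → ℕ := fun i => f (i + 1)

section Rotation

variable {p : ℕ} [NeZero p]

theorem rotateOne_iterate (k : ℕ) (f : Fin p → ℕ) :
    rotateOne^[k] f = fun i => f (i + Fin.ofNat p k) := by
  induction k generalizing f with
  | zero => simp
  | succ k ih =>
    rw [iterate_succ_apply, ih]
    ext i
    simp only [rotateOne]
    congr 1
    ext
    simp [Fin.val_add, add_assoc]

theorem isPeriodicPt_rotateOne (f : Fin p → ℕ) : IsPeriodicPt rotateOne p f := by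
  rw [IsPeriodicPt, IsFixedPt, rotateOne_iterate]
  simp

theorem mem_periodicPts_rotateOne (f : Fin p → ℕ) : f ∈ periodicPts rotateOne :=
  ⟨p, NeZero.pos p, isPeriodicPt_rotateOne f⟩

theorem mem_orbitOf_iff {f g : Fin p → ℕ} : g ∈ orbitOf f ↔ ∃ k, rotateOne^[k] f = g := by
  constructor
  · rintro ⟨k, rfl⟩
    exact ⟨k, by rw [rotateOne_iterate]; simp⟩
  · rintro ⟨k, rfl⟩
    exact ⟨Fin.ofNat p k, rotateOne_iterate k f⟩

theorem self_mem_orbitOf (f : Fin p → ℕ) : f ∈ orbitOf f :=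
  mem_orbitOf_iff.2 ⟨0, rfl⟩

theorem orbitOf_eq_of_mem {f g : Fin p → ℕ} (h : g ∈ orbitOf f) : orbitOf g = orbitOf f := by
  obtain ⟨k, rfl⟩ := mem_orbitOf_iff.1 h
  ext x
  simp only [mem_orbitOf_iff]
  constructor
  · rintro ⟨j, rfl⟩
    exact ⟨j + k, iterate_add_apply _ _ _ _⟩
  · rintro ⟨j, rfl⟩
    refine ⟨j + (p - 1) * k, ?_⟩
    rw [← iterate_add_apply, add_assoc, ← add_one_mul, Nat.sub_add_cancel NeZero.one_le,
      iterate_add_apply, (isPeriodicPt_rotateOne f).mul_const k]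

theorem IsComp.of_mem_orbitOf {n : ℕ} {f g : Fin p → ℕ} (hf : IsComp n p f)
    (h : g ∈ orbitOf f) : IsComp n p g := by
  obtain ⟨k, rfl⟩ := h
  refine ⟨fun i => hf.1 _, ?_⟩
  rw [← hf.2]
  exact Equiv.sum_comp (Equiv.addRight k) f

theorem ncard_orbitOf (f : Fin p → ℕ) : (orbitOf f).ncard = minimalPeriod rotateOne f := by
  have h : orbitOf f = (fun k => rotateOne^[k] f) '' Set.Iio (minimalPeriod rotateOne f) := by
    ext g
    rw [mem_orbitOf_iff]
    constructor
    · rintro ⟨k, rfl⟩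
      exact ⟨k % minimalPeriod rotateOne f,
        Nat.mod_lt _ (minimalPeriod_pos_of_mem_periodicPts (mem_periodicPts_rotateOne f)),
        iterate_mod_minimalPeriod_eq⟩
    · rintro ⟨k, -, rfl⟩
      exact ⟨k, rfl⟩
  rw [h, iterate_injOn_Iio_minimalPeriod.ncard_image, ← Finset.coe_Iio,
    Set.ncard_coe_finset, Nat.card_Iio]

end Rotation

/-- Repeating a `d`-tuple `a` times. -/
def repeatTuple (a : ℕ) {d : ℕ} (g : Fin d → ℕ) : Fin (a * d) → ℕ := fun i => g i.modNat

theorem modNat_finProdFinEquiv {a d : ℕ} (x : Fin a) (y : Fin d) :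
    (finProdFinEquiv (x, y)).modNat = y :=
  congrArg Prod.snd (finProdFinEquiv.symm_apply_apply (x, y))

theorem repeatTuple_injective {a d : ℕ} (ha : 0 < a) : Injective (repeatTuple a (d := d)) := by
  intro g h hgh
  ext y
  have := congrFun hgh (finProdFinEquiv (⟨0, ha⟩, y))
  simpa only [repeatTuple, modNat_finProdFinEquiv] using this

theorem sum_repeatTuple (a : ℕ) {d : ℕ} (g : Fin d → ℕ) :
    ∑ i, repeatTuple a g i = a * ∑ i, g i := by
  calc ∑ i, repeatTuple a g i = ∑ x : Fin a × Fin d, g x.2 :=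
        finProdFinEquiv.symm.sum_comp fun x : Fin a × Fin d => g x.2
    _ = a * ∑ i, g i := by simp [Fintype.sum_prod_type]

theorem isPeriodicPt_rotateOne_iff_mem_range {a d : ℕ} [NeZero (a * d)] (f : Fin (a * d) → ℕ) :
    IsPeriodicPt rotateOne d f ↔ f ∈ Set.range (repeatTuple a (d := d)) := by
  have hda : 0 < a * d := NeZero.pos _
  have ha : 0 < a := Nat.pos_of_mul_pos_right hda
  constructor
  · intro h
    refine ⟨fun y => f (finProdFinEquiv (⟨0, ha⟩, y)), ?_⟩
    ext i
    have hi := congrFun (h.mul_const (i / d)) (finProdFinEquiv (⟨0, ha⟩, i.modNat))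
    rw [rotateOne_iterate] at hi
    have h_add : finProdFinEquiv (⟨0, ha⟩, i.modNat) + Fin.ofNat (a * d) (d * (i / d)) = i := by
      ext
      simp [Fin.val_add, finProdFinEquiv, Nat.mod_add_div, Nat.mod_eq_of_lt i.2]
    simp only [h_add] at hi
    exact hi.symm
  · rintro ⟨g, rfl⟩
    rw [IsPeriodicPt, IsFixedPt, rotateOne_iterate]
    ext i
    simp only [repeatTuple]
    congr 1
    ext
    simp [Fin.val_add]

open Classical in
theorem card_filter_isPeriodicPt {n a d : ℕ} [NeZero (a * d)] (ha : a ∣ n) :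
    {f ∈ compositionFinset n (a * d) | IsPeriodicPt rotateOne d f}.card =
      (compositionFinset (n / a) d).card := by
  have hda : 0 < a * d := NeZero.pos _
  have ha' : 0 < a := Nat.pos_of_mul_pos_right hda
  rw [← Finset.card_image_of_injective (compositionFinset (n / a) d) (repeatTuple_injective ha')]
  refine congrArg Finset.card ?_
  ext f
  simp only [Finset.mem_filter, Finset.mem_image, isPeriodicPt_rotateOne_iff_mem_range,
    mem_compositionFinset]
  have key (g : Fin d → ℕ) : IsComp n (a * d) (repeatTuple a g) ↔ IsComp (n / a) d g := by
    unfold IsComp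
    rw [sum_repeatTuple, Nat.eq_div_iff_mul_eq_left ha'.ne' ha, eq_comm (a := n),
      mul_comm _ a]
    refine and_congr_left fun _ => ⟨fun h y => ?_, fun h i => h _⟩
    simpa only [repeatTuple, modNat_finProdFinEquiv] using h (finProdFinEquiv (⟨0, ha'⟩, y))
  constructor
  · rintro ⟨h, g, rfl⟩
    exact ⟨g, (key g).1 h, rfl⟩
  · rintro ⟨g, h, rfl⟩
    exact ⟨(key g).2 h, g, rfl⟩

theorem dvd_of_isPeriodicPt {n a d : ℕ} [NeZero (a * d)] {f : Fin (a * d) → ℕ}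
    (hf : IsComp n (a * d) f) (h : IsPeriodicPt rotateOne d f) : a ∣ n := by
  obtain ⟨g, rfl⟩ := (isPeriodicPt_rotateOne_iff_mem_range f).1 h
  rw [← hf.2, sum_repeatTuple]
  exact dvd_mul_right _ _

open ArithmeticFunction in
theorem sum_divisors_moebius (m : ℕ) :
    ∑ a ∈ m.divisors, moebius a = if m = 1 then 1 else 0 := by
  rw [← coe_mul_zeta_apply, moebius_mul_coe_zeta, one_apply]

open ArithmeticFunction in
open Classical in
theorem sum_moebius_isPeriodicPt {p : ℕ} [NeZero p] (f : Fin p → ℕ) :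
    ∑ a ∈ p.divisors, (if IsPeriodicPt rotateOne (p / a) f then moebius a else 0) =
      if minimalPeriod rotateOne f = p then 1 else 0 := by
  obtain ⟨b, hb⟩ := (isPeriodicPt_rotateOne f).minimalPeriod_dvd
  set m := minimalPeriod rotateOne f with hm
  have hp : 0 < p := NeZero.pos p
  have hm0 : 0 < m := minimalPeriod_pos_of_mem_periodicPts (mem_periodicPts_rotateOne f)
  have hb0 : b ≠ 0 := by rintro rfl; omega
  have hmp : m = p ↔ b = 1 := by
    rw [hb, eq_comm, Nat.mul_eq_left hm0.ne']
  rw [← Finset.sum_filter]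
  simp_rw [hmp]
  rw [← sum_divisors_moebius]
  congr 1
  ext a
  simp only [Finset.mem_filter, Nat.mem_divisors, isPeriodicPt_iff_minimalPeriod_dvd, ← hm]
  constructor
  · rintro ⟨⟨⟨c, hc⟩, -⟩, h⟩
    have ha : 0 < a := Nat.pos_of_ne_zero (by rintro rfl; omega)
    rw [hc, Nat.mul_div_cancel_left _ ha] at h
    obtain ⟨e, rfl⟩ := h
    refine ⟨⟨e, Nat.eq_of_mul_eq_mul_left hm0 ?_⟩, hb0⟩
    rw [← hb, hc]
    ring
  · rintro ⟨⟨e, rfl⟩, -⟩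
    have ha : 0 < a := Nat.pos_of_ne_zero (by rintro rfl; simp at hb0)
    have hpe : p = a * (m * e) := by rw [hb]; ring
    refine ⟨⟨⟨_, hpe⟩, hp.ne'⟩, ?_⟩
    rw [hpe, Nat.mul_div_cancel_left _ ha]
    exact dvd_mul_right _ _

open Classical in
theorem mul_cyPrim (n p : ℕ) [NeZero p] :
    p * CyPrim n p = {f ∈ compositionFinset n p | minimalPeriod rotateOne f = p}.card := by
  set P := {f ∈ compositionFinset n p | minimalPeriod rotateOne f = p} with hP
  have hset : {S | ∃ f : Fin p → ℕ, IsComp n p f ∧ S = orbitOf f ∧ S.ncard = p} =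
      (P.image orbitOf : Finset (Set (Fin p → ℕ))) := by
    ext S
    simp only [hP, Set.mem_ofPred_eq, Finset.coe_image, Set.mem_image, Finset.mem_coe,
      Finset.mem_filter, mem_compositionFinset, ← ncard_orbitOf]
    constructor
    · rintro ⟨f, hf, rfl, h⟩
      exact ⟨f, ⟨hf, h⟩, rfl⟩
    · rintro ⟨f, ⟨hf, h⟩, rfl⟩
      exact ⟨f, hf, rfl, h⟩
  rw [CyPrim, hset, Set.ncard_coe_finset, Finset.card_eq_sum_card_image orbitOf P,
    Finset.sum_const_nat (m := p), mul_comm]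
  intro S hS
  obtain ⟨f, hf, rfl⟩ := Finset.mem_image.1 hS
  rw [hP, Finset.mem_filter, mem_compositionFinset, ← ncard_orbitOf] at hf
  refine Eq.trans ?_ hf.2
  rw [← Set.ncard_coe_finset]
  congr 1
  ext g
  simp only [hP, Finset.coe_filter, Finset.mem_filter, Set.mem_ofPred_eq, mem_compositionFinset,
    ← ncard_orbitOf]
  constructor
  · rintro ⟨-, h⟩
    exact h ▸ self_mem_orbitOf g
  · intro h
    have hgf := orbitOf_eq_of_mem h
    exact ⟨⟨hf.1.of_mem_orbitOf h, hgf ▸ hf.2⟩, hgf⟩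

open ArithmeticFunction in
theorem mul_cyPrim_eq_sum (n p : ℕ) [NeZero p] (hpn : p ≤ n) :
    (p * CyPrim n p : ℤ) =
      ∑ a ∈ (Nat.gcd n p).divisors, moebius a * ((compositionFinset (n / a) (p / a)).card : ℤ) := by
  classical
  have hp : 0 < p := NeZero.pos p
  have hn : 0 < n := hp.trans_le hpn
  have hdiv : (Nat.gcd n p).divisors = {a ∈ p.divisors | a ∣ n} := by
    ext a
    simp only [Nat.mem_divisors, Finset.mem_filter, Nat.dvd_gcd_iff, ne_eq, Nat.gcd_eq_zero_iff]
    grind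
  rw [hdiv, Finset.sum_filter]
  have h := congrArg (Nat.cast : ℕ → ℤ) (mul_cyPrim n p)
  rw [Nat.cast_mul] at h
  rw [h, Finset.card_filter, Nat.cast_sum]
  push_cast
  simp_rw [← sum_moebius_isPeriodicPt]
  rw [Finset.sum_comm]
  refine Finset.sum_congr rfl fun a ha => ?_
  obtain ⟨d, rfl⟩ := Nat.dvd_of_mem_divisors ha
  rw [Nat.mul_div_cancel_left _ (Nat.pos_of_mul_pos_right hp), ← Finset.sum_filter,
    Finset.sum_const, nsmul_eq_mul]
  split_ifs with han
  · rw [card_filter_isPeriodicPt han, mul_comm]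
  · rw [Finset.filter_false_of_mem, Finset.card_empty]
    · simp
    · exact fun f hf h => han (dvd_of_isPeriodicPt (mem_compositionFinset.1 hf) h)

open ArithmeticFunction in
/-- The number of primitive cyclic compositions of `n` into `p` parts is
`Cy_prim(n,p) = (1/n) ∑_{a | gcd(n,p)} μ(a) C(n/a, p/a)`, `μ` the Möbius function. -/
theorem primitive_cyclic_composition_count (n p : ℕ) (hp : 1 ≤ p) (hpn : p ≤ n) :
    (CyPrim n p : ℚ) = 1 / (n : ℚ) *
      ∑ a ∈ (Nat.gcd n p).divisors,
        (moebius a : ℚ) * (Nat.choose (n / a) (p / a) : ℚ) := by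
  have : NeZero p := ⟨by omega⟩
  have hp0 : (p : ℚ) ≠ 0 := NeZero.ne _
  have hn0 : (n : ℚ) ≠ 0 := by
    rw [Nat.cast_ne_zero]
    omega
  have h := congrArg (Int.cast : ℤ → ℚ) (mul_cyPrim_eq_sum n p hpn)
  push_cast at h
  refine mul_left_cancel₀ hp0 ?_
  rw [h, Finset.mul_sum, Finset.mul_sum]
  refine Finset.sum_congr rfl fun a ha => ?_
  have hag := Nat.dvd_of_mem_divisors ha
  obtain ⟨m, rfl⟩ := hag.trans (Nat.gcd_dvd_left n p)
  obtain ⟨d, rfl⟩ := hag.trans (Nat.gcd_dvd_right _ p)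
  have ha0 : 0 < a := Nat.pos_of_mul_pos_right hp
  have hd0 : 1 ≤ d := Nat.pos_of_mul_pos_left hp
  have hdm : d ≤ m := Nat.le_of_mul_le_mul_left hpn ha0
  have key := congrArg (Nat.cast : ℕ → ℚ) (mul_card_compositionFinset hd0 hdm)
  push_cast at key
  rw [Nat.mul_div_cancel_left _ ha0, Nat.mul_div_cancel_left _ ha0]
  push_cast at hn0 ⊢
  have hm0 : (m : ℚ) ≠ 0 := right_ne_zero_of_mul hn0
  rw [eq_div_of_mul_eq hm0 ((mul_comm _ _).trans key)]
  field_simp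
end
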